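/- arXiv:math/9810169 — 4 statements merged into one kernel-verified Lean document; each statement's English description precedes it below -/
import Mathlib

section
/- Let (E) be the class of continuous functions g : (0,∞) → ℂ for which there exists ε > 0 such that u ↦ g(u)·K_ε(u) has bounded total variation on (0,∞) and such that ∫_ℝ |ĝ(c+it)|·log(2+|t|) dt < ∞ for every c with −ε < c < 1+ε. Then (E) is stable under the transpose g ↦ g^τ and under multiplicative convolution: if g, k ∈ (E) then the function (g∗k)(u) = ∫₀^∞ g(u/v)·k(v) dv/v belongs to (E). -/
open Complex MeasureTheory Set

/-- The class `(E)`: continuous functions `g` on `(0,∞)` such that, for some `ε > 0`,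
`u ↦ g(u)·(u^(-ε)+u^(1+ε))` has bounded total variation on `(0,∞)` and
`∫_ℝ |ĝ(c+it)|·log(2+|t|) dt < ∞` for every `-ε < c < 1+ε`. -/
def MemClassE (g : ℝ → ℂ) : Prop :=
  ContinuousOn g (Ioi 0) ∧
  ∃ ε : ℝ, 0 < ε ∧
    BoundedVariationOn (fun u : ℝ => g u * ((u ^ (-ε) + u ^ (1 + ε) : ℝ) : ℂ)) (Ioi 0) ∧
    ∀ c : ℝ, -ε < c → c < 1 + ε →
      Integrable (fun t : ℝ => ‖mellin g (c + t * I)‖ * Real.log (2 + |t|))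

theorem MonotoneOn.boundedVariationOn_of_mapsTo_Icc {α : Type*} [LinearOrder α] {f : α → ℝ}
    {s : Set α} {a b : ℝ} (hf : MonotoneOn f s) (h : MapsTo f s (Icc a b)) :
    BoundedVariationOn f s :=
  ne_top_of_le_ne_top (BoundedVariationOn.id_Icc a b)
    (eVariationOn.comp_le_of_monotoneOn id f hf h)

theorem AntitoneOn.boundedVariationOn_of_mapsTo_Icc {α : Type*} [LinearOrder α] {f : α → ℝ}
    {s : Set α} {a b : ℝ} (hf : AntitoneOn f s) (h : MapsTo f s (Icc a b)) :
    BoundedVariationOn f s :=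
  ne_top_of_le_ne_top (BoundedVariationOn.id_Icc a b)
    (eVariationOn.comp_le_of_antitoneOn id f hf h)

theorem eVariationOn_add_le {α E : Type*} [LinearOrder α] [SeminormedAddCommGroup E]
    (f g : α → E) (s : Set α) :
    eVariationOn (fun x => f x + g x) s ≤ eVariationOn f s + eVariationOn g s := by
  refine iSup_le fun ⟨n, u, hu, us⟩ => ?_
  calc
    ∑ i ∈ Finset.range n, edist (f (u (i + 1)) + g (u (i + 1))) (f (u i) + g (u i))
        ≤ ∑ i ∈ Finset.range n,
            (edist (f (u (i + 1))) (f (u i)) + edist (g (u (i + 1))) (g (u i))) :=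
      Finset.sum_le_sum fun i _ => edist_add_add_le _ _ _ _
    _ ≤ eVariationOn f s + eVariationOn g s := by
      rw [Finset.sum_add_distrib]
      exact add_le_add (eVariationOn.sum_le hu us) (eVariationOn.sum_le hu us)

theorem eVariationOn_integral_le {α β E : Type*} [LinearOrder α] [MeasurableSpace β]
    [NormedAddCommGroup E] [NormedSpace ℝ E] {μ : Measure β} {F : α → β → E} {s : Set α}
    (hF : ∀ x ∈ s, Integrable (F x) μ) :
    eVariationOn (fun x => ∫ y, F x y ∂μ) s ≤ ∫⁻ y, eVariationOn (fun x => F x y) s ∂μ := by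
  refine iSup_le fun ⟨n, u, hu, us⟩ => ?_
  calc
    ∑ i ∈ Finset.range n, edist (∫ y, F (u (i + 1)) y ∂μ) (∫ y, F (u i) y ∂μ)
        ≤ ∑ i ∈ Finset.range n, ∫⁻ y, edist (F (u (i + 1)) y) (F (u i) y) ∂μ := by
      refine Finset.sum_le_sum fun i _ => ?_
      simp_rw [edist_eq_enorm_sub]
      rw [← integral_sub (hF _ (us _)) (hF _ (us _))]
      exact enorm_integral_le_lintegral_enorm _
    _ = ∫⁻ y, ∑ i ∈ Finset.range n, edist (F (u (i + 1)) y) (F (u i) y) ∂μ := by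
      refine (lintegral_finsetSum' _ fun i _ => ?_).symm
      simp_rw [edist_eq_enorm_sub]
      exact ((hF _ (us _)).sub (hF _ (us _))).aestronglyMeasurable.enorm
    _ ≤ ∫⁻ y, eVariationOn (fun x => F x y) s ∂μ :=
      lintegral_mono fun y => eVariationOn.sum_le (f := fun x => F x y) hu us

/-- The ratio of `u ^ a` to the weight `u ^ (-ε) + u ^ (1 + ε)` has bounded variation. -/
theorem boundedVariationOn_rpow_div {ε a : ℝ} (hε : 0 < ε) (ha : -ε ≤ a) (ha' : a ≤ 1 + ε) :
    BoundedVariationOn (fun u : ℝ => u ^ a / (u ^ (-ε) + u ^ (1 + ε))) (Ioi 0) := by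
  have hsplit : Ioi (0 : ℝ) = Ioc 0 1 ∪ Ici 1 := (Ioc_union_Ici_eq_Ioi one_pos).symm
  rw [BoundedVariationOn, hsplit,
    eVariationOn.union _ (isGreatest_Ioc one_pos) isLeast_Ici]
  refine ENNReal.add_ne_top.2 ⟨?_, ?_⟩
  · have h1 : BoundedVariationOn (fun u : ℝ => u ^ (a + ε)) (Ioc 0 1) := by
      refine MonotoneOn.boundedVariationOn_of_mapsTo_Icc (a := 0) (b := 1) ?_ ?_
      · exact fun x hx y _ hxy => Real.rpow_le_rpow hx.1.le hxy (by linarith)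
      · exact fun x hx => ⟨by have := hx.1; positivity,
          Real.rpow_le_one hx.1.le hx.2 (by linarith)⟩
    have h2 : BoundedVariationOn (fun u : ℝ => (1 + u ^ (1 + 2 * ε))⁻¹) (Ioc 0 1) := by
      refine AntitoneOn.boundedVariationOn_of_mapsTo_Icc (a := 0) (b := 1) ?_ ?_
      · intro x hx y _ hxy
        have := hx.1
        have := Real.rpow_le_rpow hx.1.le hxy (z := 1 + 2 * ε) (by linarith)
        dsimp only
        gcongr
      · intro x hx
        have := hx.1
        exact ⟨by positivity, inv_le_one_of_one_le₀ (le_add_of_nonneg_right (by positivity))⟩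
    refine ne_of_eq_of_ne (eVariationOn.congr fun u hu => ?_) (h1.mul h2)
    have hu0 : 0 < u := hu.1
    have e1 : u ^ (a + ε) = u ^ a / u ^ (-ε) := by rw [← Real.rpow_sub hu0]; ring_nf
    have e2 : u ^ (1 + 2 * ε) = u ^ (1 + ε) / u ^ (-ε) := by
      rw [← Real.rpow_sub hu0]; ring_nf
    simp only [Pi.mul_apply, e1, e2]
    have := Real.rpow_pos_of_pos hu0 (-ε)
    have := Real.rpow_pos_of_pos hu0 (1 + ε)
    field_simp
  · have h1 : BoundedVariationOn (fun u : ℝ => u ^ (a - (1 + ε))) (Ici 1) := by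
      refine AntitoneOn.boundedVariationOn_of_mapsTo_Icc (a := 0) (b := 1) ?_ ?_
      · exact fun x hx y _ hxy => Real.rpow_le_rpow_of_nonpos (one_pos.trans_le hx) hxy
          (by linarith)
      · exact fun x hx => ⟨Real.rpow_nonneg (zero_le_one.trans hx) _,
          Real.rpow_le_one_of_one_le_of_nonpos hx (by linarith)⟩
    have h2 : BoundedVariationOn (fun u : ℝ => (1 + u ^ (-(1 + 2 * ε)))⁻¹) (Ici 1) := by
      refine MonotoneOn.boundedVariationOn_of_mapsTo_Icc (a := 0) (b := 1) ?_ ?_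
      · intro x hx y hy hxy
        have hx0 : 0 < x := one_pos.trans_le hx
        have hy0 : 0 < y := one_pos.trans_le hy
        have := Real.rpow_le_rpow_of_nonpos hx0 hxy (z := -(1 + 2 * ε)) (by linarith)
        dsimp only
        gcongr
      · intro x hx
        have : (0 : ℝ) < x := one_pos.trans_le hx
        exact ⟨by positivity, inv_le_one_of_one_le₀ (le_add_of_nonneg_right (by positivity))⟩
    refine ne_of_eq_of_ne (eVariationOn.congr fun u hu => ?_) (h1.mul h2)
    have hu0 : 0 < u := one_pos.trans_le hu
    have e1 : u ^ (a - (1 + ε)) = u ^ a / u ^ (1 + ε) := Real.rpow_sub hu0 _ _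
    have e2 : u ^ (-(1 + 2 * ε)) = u ^ (-ε) / u ^ (1 + ε) := by
      rw [← Real.rpow_sub hu0]; ring_nf
    simp only [Pi.mul_apply, e1, e2]
    have := Real.rpow_pos_of_pos hu0 (-ε)
    have := Real.rpow_pos_of_pos hu0 (1 + ε)
    field_simp
    ring

theorem BoundedVariationOn.rpow_mul_of_mul_weight {g : ℝ → ℂ} {ε a : ℝ} (hε : 0 < ε)
    (hg : BoundedVariationOn
      (fun u : ℝ => g u * ((u ^ (-ε) + u ^ (1 + ε) : ℝ) : ℂ)) (Ioi 0))
    (ha : -ε ≤ a) (ha' : a ≤ 1 + ε) :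
    BoundedVariationOn (fun u : ℝ => ((u ^ a : ℝ) : ℂ) * g u) (Ioi 0) := by
  refine ne_of_eq_of_ne (eVariationOn.congr fun u hu => ?_)
    ((boundedVariationOn_rpow_div hε ha ha').smul hg)
  have h1 := Real.rpow_pos_of_pos hu (-ε)
  have h2 := Real.rpow_pos_of_pos hu (1 + ε)
  have h3 : ((u ^ (-ε) + u ^ (1 + ε) : ℝ) : ℂ) ≠ 0 := ofReal_ne_zero.2 (by positivity)
  simp only [Pi.smul_apply', real_smul]
  rw [ofReal_div]
  field_simp

theorem BoundedVariationOn.exists_norm_le {α E : Type*} [LinearOrder α]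
    [SeminormedAddCommGroup E] {f : α → E} {s : Set α} (hf : BoundedVariationOn f s) :
    ∃ C, ∀ x ∈ s, ‖f x‖ ≤ C := by
  rcases s.eq_empty_or_nonempty with rfl | ⟨y, hy⟩
  · simp
  · refine ⟨‖f y‖ + (eVariationOn f s).toReal, fun x hx => ?_⟩
    have h := hf.dist_le hx hy
    rw [dist_eq_norm] at h
    linarith [norm_le_norm_add_norm_sub' (f x) (f y)]

theorem exists_norm_le_rpow_of_mul_weight {g : ℝ → ℂ} {ε a : ℝ} (hε : 0 < ε)
    (hg : BoundedVariationOn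
      (fun u : ℝ => g u * ((u ^ (-ε) + u ^ (1 + ε) : ℝ) : ℂ)) (Ioi 0))
    (ha : -ε ≤ a) (ha' : a ≤ 1 + ε) :
    ∃ C, ∀ u : ℝ, 0 < u → ‖g u‖ ≤ C * u ^ (-a) := by
  obtain ⟨C, hC⟩ := (hg.rpow_mul_of_mul_weight hε ha ha').exists_norm_le
  refine ⟨C, fun u hu => ?_⟩
  have h := hC u hu
  have hp := Real.rpow_pos_of_pos hu a
  rw [norm_mul, norm_real, Real.norm_of_nonneg hp.le] at h
  rw [Real.rpow_neg hu.le, ← div_eq_mul_inv, le_div_iff₀ hp]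
  linarith

theorem mellinConvergent_of_mul_weight {g : ℝ → ℂ} {ε : ℝ} {s : ℂ} (hε : 0 < ε)
    (hc : ContinuousOn g (Ioi 0))
    (hg : BoundedVariationOn
      (fun u : ℝ => g u * ((u ^ (-ε) + u ^ (1 + ε) : ℝ) : ℂ)) (Ioi 0))
    (hs : -ε < s.re) (hs' : s.re < 1 + ε) : MellinConvergent g s := by
  refine mellinConvergent_of_isBigO_rpow (a := 1 + ε) (b := -ε)
    (hc.locallyIntegrableOn measurableSet_Ioi) ?_ hs' ?_ hs
  · obtain ⟨C, hC⟩ := exists_norm_le_rpow_of_mul_weight (a := 1 + ε) hε hg (by linarith) le_rfl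
    refine Asymptotics.IsBigO.of_bound C ?_
    filter_upwards [Filter.eventually_gt_atTop 0] with u hu
    rw [Real.norm_of_nonneg (Real.rpow_nonneg hu.le _)]
    exact hC u hu
  · obtain ⟨C, hC⟩ := exists_norm_le_rpow_of_mul_weight (a := -ε) hε hg le_rfl (by linarith)
    refine Asymptotics.IsBigO.of_bound C ?_
    filter_upwards [self_mem_nhdsWithin] with u hu
    rw [Real.norm_of_nonneg (Real.rpow_nonneg (le_of_lt hu) _)]
    exact hC u hu

/-- The Mellin transform turns multiplicative convolution into multiplication. -/
theorem mellin_mulConvolution {g k : ℝ → ℂ} {s : ℂ} (hgc : ContinuousOn g (Ioi 0))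
    (hkc : ContinuousOn k (Ioi 0)) (hg : MellinConvergent g s) (hk : MellinConvergent k s) :
    mellin (fun u : ℝ => ∫ v in Ioi (0 : ℝ), g (u / v) * k v / (v : ℂ)) s =
      mellin g s * mellin k s := by
  set F : ℝ → ℝ → ℂ := fun u v => (u : ℂ) ^ (s - 1) * (g (u / v) * k v / (v : ℂ)) with hF
  have hFeq : ∀ u ∈ Ioi (0 : ℝ), ∀ v ∈ Ioi (0 : ℝ), F u v =
      ((u * v⁻¹ : ℝ) : ℂ) ^ (s - 1) * g (u * v⁻¹) * ((v : ℂ) ^ (s - 1) * k v) * ((v⁻¹ : ℝ) : ℂ) := by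
    intro u hu v hv
    have hu0 : (0 : ℝ) < u := hu
    have hv0 : (0 : ℝ) < v := hv
    have e : (u : ℂ) ^ (s - 1) = ((u * v⁻¹ : ℝ) : ℂ) ^ (s - 1) * (v : ℂ) ^ (s - 1) := by
      rw [← mul_cpow_ofReal_nonneg (by positivity) hv0.le, ← ofReal_mul,
        inv_mul_cancel_right₀ hv0.ne']
    simp only [hF]
    rw [e, ofReal_inv, div_eq_mul_inv u v]
    ring
  have hcont : ContinuousOn (Function.uncurry F) (Ioi 0 ×ˢ Ioi 0) := by
    have hv : ∀ p ∈ Ioi (0 : ℝ) ×ˢ Ioi (0 : ℝ), (p.2 : ℂ) ≠ 0 := fun p hp =>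
      ofReal_ne_zero.2 (ne_of_gt hp.2)
    have h1 : ContinuousOn (fun p : ℝ × ℝ => g (p.1 / p.2)) (Ioi 0 ×ˢ Ioi 0) :=
      hgc.comp (continuousOn_fst.div continuousOn_snd fun p hp => ne_of_gt hp.2)
        fun p hp => mem_Ioi.2 (div_pos hp.1 hp.2)
    have h2 : ContinuousOn (fun p : ℝ × ℝ => k p.2) (Ioi 0 ×ˢ Ioi 0) :=
      hkc.comp continuousOn_snd fun p hp => hp.2
    have h3 : ContinuousOn (fun p : ℝ × ℝ => (p.1 : ℂ) ^ (s - 1)) (Ioi 0 ×ˢ Ioi 0) :=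
      (continuous_ofReal.comp_continuousOn continuousOn_fst).cpow_const fun p hp =>
        ofReal_mem_slitPlane.2 hp.1
    exact h3.mul ((h1.mul h2).div (continuous_ofReal.comp_continuousOn continuousOn_snd) hv)
  have hint : Integrable (Function.uncurry F)
      ((volume.restrict (Ioi 0)).prod (volume.restrict (Ioi 0))) := by
    rw [integrable_prod_iff']
    · constructor
      · filter_upwards [ae_restrict_mem measurableSet_Ioi] with v hv
        have h := (integrableOn_Ioi_comp_mul_right_iff
          (fun t : ℝ => (t : ℂ) ^ (s - 1) • g t) 0 (inv_pos.2 hv)).2 (by rw [zero_mul]; exact hg)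
        exact ((h.mul_const ((v : ℂ) ^ (s - 1) * k v)).mul_const ((v⁻¹ : ℝ) : ℂ)).congr <|
          (ae_restrict_mem measurableSet_Ioi).mono fun u hu => (hFeq u hu v hv).symm
      · refine (hk.norm.const_mul (∫ t in Ioi (0 : ℝ), ‖(t : ℂ) ^ (s - 1) * g t‖)).congr ?_
        filter_upwards [ae_restrict_mem measurableSet_Ioi] with v hv
        have hv0 : (0 : ℝ) < v := hv
        have h := integral_comp_mul_right_Ioi
          (fun t : ℝ => ‖(t : ℂ) ^ (s - 1) * g t‖) 0 (inv_pos.2 hv0)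
        rw [zero_mul, inv_inv, smul_eq_mul] at h
        simp only [Function.uncurry_apply_pair]
        rw [setIntegral_congr_fun measurableSet_Ioi fun u hu =>
          congrArg norm (hFeq u hu v hv)]
        simp_rw [norm_mul _ ((v⁻¹ : ℝ) : ℂ), norm_mul _ ((v : ℂ) ^ (s - 1) * k v)]
        rw [integral_mul_const, integral_mul_const, h, norm_real,
          Real.norm_of_nonneg (inv_nonneg.2 hv0.le), smul_eq_mul]
        field_simp
    · rw [Measure.prod_restrict]
      exact hcont.aestronglyMeasurable (measurableSet_Ioi.prod measurableSet_Ioi)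
  calc
    mellin (fun u : ℝ => ∫ v in Ioi (0 : ℝ), g (u / v) * k v / (v : ℂ)) s
        = ∫ u in Ioi (0 : ℝ), ∫ v in Ioi (0 : ℝ), F u v := by
      simp only [mellin, hF, smul_eq_mul, integral_const_mul]
    _ = ∫ v in Ioi (0 : ℝ), ∫ u in Ioi (0 : ℝ), F u v := integral_integral_swap hint
    _ = ∫ v in Ioi (0 : ℝ), mellin g s * ((v : ℂ) ^ (s - 1) * k v) := by
      refine setIntegral_congr_fun measurableSet_Ioi fun v hv => ?_
      have hv0 : (0 : ℝ) < v := hv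
      have h := integral_comp_mul_right_Ioi
        (fun t : ℝ => (t : ℂ) ^ (s - 1) * g t) 0 (inv_pos.2 hv0)
      rw [zero_mul, inv_inv, real_smul] at h
      rw [setIntegral_congr_fun measurableSet_Ioi fun u hu => hFeq u hu v hv,
        integral_mul_const, integral_mul_const, h, ofReal_inv]
      have : (v : ℂ) ≠ 0 := ofReal_ne_zero.2 hv0.ne'
      simp only [mellin, smul_eq_mul]
      field_simp
    _ = mellin g s * mellin k s := by
      rw [integral_const_mul]
      simp only [mellin, smul_eq_mul]

theorem MemClassE.transpose {g : ℝ → ℂ} (hg : MemClassE g) :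
    MemClassE (fun x : ℝ => ((x⁻¹ : ℝ) : ℂ) * g x⁻¹) := by
  obtain ⟨hc, ε, hε, hbv, hint⟩ := hg
  have hanti : AntitoneOn (fun x : ℝ => x⁻¹) (Ioi 0) :=
    fun x hx y _ hxy => inv_anti₀ hx hxy
  have hmaps : MapsTo (fun x : ℝ => x⁻¹) (Ioi 0) (Ioi 0) := fun x hx =>
    mem_Ioi.2 (inv_pos.2 hx)
  have hinv : ContinuousOn (fun x : ℝ => x⁻¹) (Ioi 0) :=
    continuousOn_id.inv₀ fun x hx => ne_of_gt hx
  refine ⟨(continuous_ofReal.comp_continuousOn hinv).mul (hc.comp hinv hmaps), ε, hε, ?_, ?_⟩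
  · refine ne_of_eq_of_ne (eVariationOn.congr fun x hx => ?_)
      (ne_top_of_le_ne_top hbv (eVariationOn.comp_le_of_antitoneOn _ _ hanti hmaps))
    have hx0 : (0 : ℝ) < x := hx
    have e1 : (x⁻¹) ^ (-ε) = x⁻¹ * x ^ (1 + ε) := by
      rw [Real.inv_rpow hx0.le, Real.rpow_neg hx0.le, inv_inv, Real.rpow_add hx0, Real.rpow_one,
        inv_mul_cancel_left₀ hx0.ne']
    have e2 : (x⁻¹) ^ (1 + ε) = x⁻¹ * x ^ (-ε) := by
      rw [Real.inv_rpow hx0.le, ← Real.rpow_neg hx0.le, neg_add, Real.rpow_add hx0,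
        Real.rpow_neg_one]
    simp only [Function.comp_apply, e1, e2]
    push_cast
    ring
  · intro c h1 h2
    have key : ∀ s : ℂ, mellin (fun x : ℝ => ((x⁻¹ : ℝ) : ℂ) * g x⁻¹) s = mellin g (1 - s) := by
      intro s
      have h := mellin_comp_inv (fun x : ℝ => (x : ℂ) ^ (1 : ℂ) • g x) s
      rw [mellin_cpow_smul] at h
      simp only [cpow_one, smul_eq_mul] at h
      rw [h]
      ring_nf
    refine (hint (1 - c) (by linarith) (by linarith)).comp_neg.congr
      (Filter.Eventually.of_forall fun t => ?_)
    simp only [key, abs_neg]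
    congr 3
    push_cast
    ring

theorem continuousOn_mulConvolution {g k : ℝ → ℂ} (hgc : ContinuousOn g (Ioi 0))
    {C : ℝ} (hC : ∀ u : ℝ, 0 < u → ‖g u‖ ≤ C)
    (hk : MellinConvergent k 0) :
    (∀ u ∈ Ioi (0 : ℝ), IntegrableOn (fun v : ℝ => g (u / v) * k v / (v : ℂ)) (Ioi 0)) ∧
    ContinuousOn (fun u : ℝ => ∫ v in Ioi (0 : ℝ), g (u / v) * k v / (v : ℂ)) (Ioi 0) := by
  have hk' : IntegrableOn (fun v : ℝ => k v / (v : ℂ)) (Ioi 0) := by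
    rw [MellinConvergent] at hk
    refine hk.congr_fun (fun v _ => ?_) measurableSet_Ioi
    simp only [zero_sub, cpow_neg_one, smul_eq_mul]
    rw [div_eq_inv_mul]
  have hbound : ∀ u ∈ Ioi (0 : ℝ), ∀ᵐ v : ℝ ∂volume.restrict (Ioi 0), ‖g (u / v)‖ ≤ C := by
    intro u hu
    filter_upwards [ae_restrict_mem measurableSet_Ioi] with v hv using hC _ (div_pos hu hv)
  have hint : ∀ u ∈ Ioi (0 : ℝ),
      IntegrableOn (fun v : ℝ => g (u / v) * (k v / (v : ℂ))) (Ioi 0) := by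
    intro u hu
    refine Integrable.bdd_mul (c := C) hk' ?_ (hbound u hu)
    exact (hgc.comp (continuousOn_const.div continuousOn_id fun v hv => ne_of_gt hv)
      fun v hv => mem_Ioi.2 (div_pos hu hv)).aestronglyMeasurable measurableSet_Ioi
  simp only [mul_div_assoc]
  refine ⟨hint, continuousOn_of_dominated (bound := fun v => C * ‖k v / (v : ℂ)‖)
    (fun u hu => (hint u hu).aestronglyMeasurable) (fun u hu => ?_) (hk'.norm.const_mul C) ?_⟩
  · filter_upwards [hbound u hu] with v hv
    rw [norm_mul]
    gcongr
  · filter_upwards [ae_restrict_mem measurableSet_Ioi] with v hv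
    exact (hgc.comp (continuousOn_id.div_const v) fun u hu => mem_Ioi.2 (div_pos hu hv)).mul
      continuousOn_const

theorem BoundedVariationOn.rpow_mul_mulConvolution {g k : ℝ → ℂ} {a : ℝ}
    (hg : BoundedVariationOn (fun u : ℝ => ((u ^ a : ℝ) : ℂ) * g u) (Ioi 0))
    (hint : ∀ u ∈ Ioi (0 : ℝ), IntegrableOn (fun v : ℝ => g (u / v) * k v / (v : ℂ)) (Ioi 0))
    (hk : MellinConvergent k a) :
    BoundedVariationOn (fun u : ℝ =>
      ((u ^ a : ℝ) : ℂ) * ∫ v in Ioi (0 : ℝ), g (u / v) * k v / (v : ℂ)) (Ioi 0) := by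
  set V := eVariationOn (fun u : ℝ => ((u ^ a : ℝ) : ℂ) * g u) (Ioi 0)
  simp only [← integral_const_mul]
  refine ne_top_of_le_ne_top ?_
    (eVariationOn_integral_le fun u hu => (hint u hu).const_mul _)
  have hle : ∀ v ∈ Ioi (0 : ℝ), eVariationOn
      (fun u : ℝ => ((u ^ a : ℝ) : ℂ) * (g (u / v) * k v / (v : ℂ))) (Ioi 0) ≤
        ‖(v : ℂ) ^ ((a : ℂ) - 1) • k v‖ₑ * V := by
    intro v hv
    have hv0 : (0 : ℝ) < v := hv
    set w : ℂ := (v : ℂ) ^ ((a : ℂ) - 1) • k v with hw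
    have hdil : eVariationOn ((fun u : ℝ => ((u ^ a : ℝ) : ℂ) * g u) ∘ fun u => u / v) (Ioi 0)
        ≤ V :=
      eVariationOn.comp_le_of_monotoneOn _ _
        (fun x _ y _ hxy => div_le_div_of_nonneg_right hxy hv0.le) fun u hu => div_pos hu hv0
    have hlip : LipschitzOnWith ‖w‖₊ (fun z : ℂ => w * z) univ :=
      (lipschitzWith_smul w).lipschitzOnWith
    refine le_trans (le_of_eq (eVariationOn.congr fun u hu => ?_))
      ((hlip.comp_eVariationOn_le (mapsTo_univ _ _)).trans (mul_le_mul_right hdil _))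
    have hvc : (v : ℂ) ≠ 0 := ofReal_ne_zero.2 hv0.ne'
    have hva : ((v ^ a : ℝ) : ℂ) ≠ 0 := ofReal_ne_zero.2 (Real.rpow_pos_of_pos hv0 a).ne'
    simp only [Function.comp_apply, hw, smul_eq_mul]
    rw [cpow_sub _ _ hvc, cpow_one, ← ofReal_cpow hv0.le, Real.div_rpow (le_of_lt hu) hv0.le,
      ofReal_div]
    field_simp
  refine ne_top_of_le_ne_top ?_ (setLIntegral_mono' measurableSet_Ioi hle)
  rw [lintegral_mul_const' _ _ hg]
  rw [MellinConvergent] at hk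
  exact ENNReal.mul_ne_top hk.2.ne hg

theorem MemClassE.mulConvolution {g k : ℝ → ℂ} (hg : MemClassE g) (hk : MemClassE k) :
    MemClassE (fun u : ℝ => ∫ v in Ioi (0 : ℝ), g (u / v) * k v / (v : ℂ)) := by
  obtain ⟨hgc, ε, hε, hgb, hgi⟩ := hg
  obtain ⟨hkc, η, hη, hkb, hki⟩ := hk
  obtain ⟨δ, hδ, hδm⟩ := exists_between (lt_min hε hη)
  obtain ⟨hδε, hδη⟩ := lt_min_iff.1 hδm
  have hgm : ∀ s : ℂ, -δ < s.re → s.re < 1 + δ → MellinConvergent g s := fun s h1 h2 =>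
    mellinConvergent_of_mul_weight hε hgc hgb (by linarith) (by linarith)
  have hkm : ∀ s : ℂ, -δ ≤ s.re → s.re ≤ 1 + δ → MellinConvergent k s := fun s h1 h2 =>
    mellinConvergent_of_mul_weight hη hkc hkb (by linarith) (by linarith)
  obtain ⟨C, hC⟩ := exists_norm_le_rpow_of_mul_weight (a := 0) hε hgb (by linarith) (by linarith)
  obtain ⟨hint, hcont⟩ := continuousOn_mulConvolution hgc (C := C)
    (fun u hu => by simpa using hC u hu) (hkm 0 (by simpa using hδ.le) (by simp; linarith))
  refine ⟨hcont, δ, hδ, ?_, fun c h1 h2 => ?_⟩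
  · have hb1 := (hgb.rpow_mul_of_mul_weight hε (a := -δ) (by linarith)
      (by linarith)).rpow_mul_mulConvolution hint
        (hkm _ (by rw [ofReal_re]) (by rw [ofReal_re]; linarith))
    have hb2 := (hgb.rpow_mul_of_mul_weight hε (a := 1 + δ) (by linarith)
      (by linarith)).rpow_mul_mulConvolution hint
        (hkm _ (by rw [ofReal_re]; linarith) (by rw [ofReal_re]))
    refine ne_of_eq_of_ne (eVariationOn.congr fun u _ => ?_)
      (ne_top_of_le_ne_top (ENNReal.add_ne_top.2 ⟨hb1, hb2⟩) (eVariationOn_add_le _ _ _))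
    push_cast
    ring
  · have hre : ∀ t : ℝ, ((c : ℂ) + t * I).re = c := fun t => by simp
    have hmul : ∀ t : ℝ, mellin (fun u : ℝ => ∫ v in Ioi (0 : ℝ), g (u / v) * k v / (v : ℂ))
        (c + t * I) = mellin g (c + t * I) * mellin k (c + t * I) := fun t =>
      mellin_mulConvolution hgc hkc (hgm _ (by rwa [hre]) (by rwa [hre]))
        (hkm _ (by rw [hre]; linarith) (by rw [hre]; linarith))
    have hlog : ∀ t : ℝ, 0 < Real.log (2 + |t|) := fun t =>
      Real.log_pos (by linarith [abs_nonneg t])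
    have hmeas : AEStronglyMeasurable (fun t : ℝ => ‖mellin g (c + t * I)‖) := by
      have hm : Measurable fun t : ℝ => (Real.log (2 + |t|))⁻¹ := by fun_prop
      refine ((hgi c (by linarith) (by linarith)).aestronglyMeasurable.mul
        hm.aestronglyMeasurable).congr (Filter.Eventually.of_forall fun t => ?_)
      exact mul_inv_cancel_right₀ (hlog t).ne' _
    refine ((hki c (by linarith) (by linarith)).bdd_mul
      (c := ∫ u in Ioi (0 : ℝ), ‖(u : ℂ) ^ ((c : ℂ) - 1) • g u‖) hmeas
      (Filter.Eventually.of_forall fun t => ?_)).congr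
        (Filter.Eventually.of_forall fun t => ?_)
    · rw [norm_norm]
      refine (norm_integral_le_integral_norm _).trans_eq
        (setIntegral_congr_fun measurableSet_Ioi fun u hu => ?_)
      simp only [norm_smul, norm_cpow_eq_rpow_re_of_pos (show (0 : ℝ) < u from hu)]
      simp
    · simp only [hmul, norm_mul, mul_assoc]

/-- The class `(E)` is stable under the transpose `g ↦ g^τ`, `g^τ(x) = (1/x)·g(1/x)`, and
under multiplicative convolution `(g∗k)(u) = ∫₀^∞ g(u/v)·k(v) dv/v`. -/
theorem classE_stable_transpose_and_convolution :
    (∀ g : ℝ → ℂ, MemClassE g → MemClassE (fun x : ℝ => ((x⁻¹ : ℝ) : ℂ) * g x⁻¹)) ∧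
    (∀ g k : ℝ → ℂ, MemClassE g → MemClassE k →
      MemClassE (fun u : ℝ => ∫ v in Ioi (0 : ℝ), g (u / v) * k v / (v : ℂ))) := by
  exact ⟨fun _ hg => hg.transpose, fun _ _ hg hk => hg.mulConvolution hk⟩
end

section
/- (Fourier transform of −log|x| on ℝ) For every Schwartz function φ : ℝ → ℂ, ∫_ℝ (−log|x|)·(𝓕φ)(x) dx = ∫_{{t : 0 < |t| ≤ 1}} (φ(t) − φ(0)) dt/(2|t|) + ∫_{{t : |t| > 1}} φ(t) dt/(2|t|) + (log(2π) + γ)·φ(0). -/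
open scoped Real FourierTransform

open Complex MeasureTheory Set

open Filter Topology

/-- `log|x|` is integrable against a continuous function with integrable first moment. -/
lemma integrable_neg_log_abs_mul {f : ℝ → ℂ} (hf : Continuous f)
    (hxf : Integrable fun x : ℝ => (x : ℂ) * f x) :
    Integrable fun x : ℝ => ((-Real.log |x| : ℝ) : ℂ) * f x := by
  have hmeas : AEStronglyMeasurable (fun x : ℝ => ((-Real.log |x| : ℝ) : ℂ) * f x) := by
    refine AEStronglyMeasurable.mul ?_ hf.aestronglyMeasurable
    exact (by fun_prop : Measurable fun x : ℝ => ((-Real.log |x| : ℝ) : ℂ)).aestronglyMeasurable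
  have hlog : IntegrableOn (fun x : ℝ => Real.log x) (Icc (-1) 1) := by
    rw [integrableOn_Icc_iff_integrableOn_Ioc,
      ← intervalIntegrable_iff_integrableOn_Ioc_of_le (by norm_num)]
    exact intervalIntegral.intervalIntegrable_log'
  rw [← integrableOn_univ, ← union_compl_self (Icc (-1 : ℝ) 1), integrableOn_union]
  constructor
  · have hlog' : IntegrableOn (fun x : ℝ => -(Real.log x : ℂ)) (Icc (-1) 1) := hlog.ofReal.neg
    refine (hlog'.mul_continuousOn hf.continuousOn isCompact_Icc).congr_fun
      (fun x _ => ?_) measurableSet_Icc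
    simp [Real.log_abs]
  · refine Integrable.mono hxf.integrableOn hmeas.restrict ?_
    refine (ae_restrict_iff' measurableSet_Icc.compl).2 (Eventually.of_forall fun x hx => ?_)
    have hx1 : 1 ≤ |x| := by
      by_contra! h
      exact hx (abs_le.1 h.le)
    rw [norm_mul, norm_mul, norm_real, norm_real, Real.norm_eq_abs, Real.norm_eq_abs, abs_neg,
      abs_of_nonneg (Real.log_nonneg hx1)]
    gcongr
    exact (Real.log_le_sub_one_of_pos (by linarith)).trans (by linarith)

lemma measurableSet_punctured_unit_ball : MeasurableSet {t : ℝ | 0 < |t| ∧ |t| ≤ 1} :=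
  (measurableSet_lt measurable_const measurable_norm).inter
    (measurableSet_le measurable_norm measurable_const)

lemma measurableSet_one_lt_abs : MeasurableSet {t : ℝ | 1 < |t|} :=
  measurableSet_lt measurable_const (by fun_prop)

lemma integrableOn_sub_div_two_mul_abs {f : ℝ → ℂ} (hf : Continuous f) {C : ℝ}
    (hC : ∀ t : ℝ, |t| ≤ 1 → ‖f t - f 0‖ ≤ C * |t|) :
    IntegrableOn (fun t : ℝ => (f t - f 0) / ((2 * |t| : ℝ) : ℂ)) {t : ℝ | 0 < |t| ∧ |t| ≤ 1} := by
  have hvol : volume {t : ℝ | 0 < |t| ∧ |t| ≤ 1} < ⊤ :=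
    (measure_mono (fun t ht => abs_le.1 ht.2)).trans_lt (measure_Icc_lt_top (a := (-1 : ℝ)) (b := 1))
  refine Measure.integrableOn_of_bounded (M := C / 2) hvol.ne ?_ ?_
  · exact (hf.measurable.sub_const _).div (by fun_prop) |>.aestronglyMeasurable
  · refine (ae_restrict_iff' measurableSet_punctured_unit_ball).2
      (Eventually.of_forall fun t ht => ?_)
    have ht0 : 0 < |t| := ht.1
    rw [norm_div, norm_real, Real.norm_eq_abs, abs_of_pos (by positivity : 0 < 2 * |t|),
      div_le_div_iff₀ (by positivity) two_pos]
    nlinarith [hC t ht.2]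

lemma integrableOn_div_two_mul_abs {f : ℝ → ℂ} (hf : Continuous f) (hfi : Integrable f) :
    IntegrableOn (fun t : ℝ => f t / ((2 * |t| : ℝ) : ℂ)) {t : ℝ | 1 < |t|} := by
  refine Integrable.mono hfi.integrableOn
    (hf.measurable.div (by fun_prop)).aestronglyMeasurable ?_
  refine (ae_restrict_iff' measurableSet_one_lt_abs).2 (Eventually.of_forall fun t ht => ?_)
  have ht1 : 1 < |t| := ht
  rw [norm_div, norm_real, Real.norm_eq_abs, abs_of_pos (by positivity : 0 < 2 * |t|)]
  exact div_le_self (norm_nonneg _) (by linarith)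

/-- The Frullani kernel `(exp(-pa) - exp(-qa)) / a` is integrable on `(0, ∞)`. -/
lemma integrableOn_frullani_exp {p q : ℝ} (hp : 0 < p) (hq : 0 < q) :
    IntegrableOn (fun a : ℝ => a⁻¹ * (Real.exp (-(p * a)) - Real.exp (-(q * a)))) (Ioi 0) := by
  wlog hpq : p ≤ q generalizing p q
  · refine (this hq hp (le_of_not_ge hpq)).neg.congr_fun (fun a _ => ?_) measurableSet_Ioi
    simp only [Pi.neg_apply]
    ring
  have hexp : IntegrableOn (fun a : ℝ => (q - p) * Real.exp (-p * a)) (Ioi 0) :=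
    (integrableOn_exp_mul_Ioi (neg_lt_zero.2 hp) 0).const_mul _
  refine Integrable.mono hexp (Measurable.aestronglyMeasurable (by fun_prop)) ?_
  refine (ae_restrict_iff' measurableSet_Ioi).2 (Eventually.of_forall fun a ha => ?_)
  have ha : 0 < a := ha
  have h1 : Real.exp (-(q * a)) ≤ Real.exp (-(p * a)) := by
    gcongr
  have h2 : Real.exp (-(q * a)) = Real.exp (-(p * a)) * Real.exp (-((q - p) * a)) := by
    rw [← Real.exp_add]; ring_nf
  have h3 := Real.add_one_le_exp (-((q - p) * a))
  have h4 := Real.exp_pos (-(p * a))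
  rw [Real.norm_of_nonneg (mul_nonneg (by positivity) (sub_nonneg.2 h1)),
    Real.norm_of_nonneg (mul_nonneg (sub_nonneg.2 hpq) (Real.exp_pos _).le),
    inv_mul_le_iff₀ ha, neg_mul, h2]
  nlinarith

lemma integral_frullani_exp {p q : ℝ} (hp : 0 < p) (hq : 0 < q) :
    ∫ a in Ioi (0 : ℝ), a⁻¹ * (Real.exp (-(p * a)) - Real.exp (-(q * a)))
      = Real.log (q / p) := by
  have hcont : Continuous fun a : ℝ => Real.exp (-a) := by fun_prop
  have h := Frullani.integral_Ioi_eq (f := fun a : ℝ => Real.exp (-a)) (L := 1) (R := 0)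
    (hcont.locallyIntegrable.locallyIntegrableOn _) hp hq
    (by simpa using (hcont.tendsto 0).mono_left (nhdsWithin_le_nhds (s := Ioi 0)))
    Real.tendsto_exp_neg_atTop_nhds_zero
    (by simpa only [smul_eq_mul] using integrableOn_frullani_exp hp hq)
  simpa using h

lemma integral_abs_frullani_exp {p q : ℝ} (hp : 0 < p) (hq : 0 < q) :
    ∫ a in Ioi (0 : ℝ), |a⁻¹ * (Real.exp (-(p * a)) - Real.exp (-(q * a)))|
      = |Real.log (q / p)| := by
  wlog hpq : p ≤ q generalizing p q
  · rw [← abs_neg, ← Real.log_inv, inv_div, ← this hq hp (le_of_not_ge hpq)]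
    congr 1 with a
    rw [← abs_neg]
    ring_nf
  rw [← integral_frullani_exp hp hq, abs_of_nonneg]
  · refine setIntegral_congr_fun measurableSet_Ioi fun a ha => abs_of_nonneg ?_
    have ha : 0 < a := ha
    exact mul_nonneg (by positivity) (sub_nonneg.2 (by gcongr))
  · rw [integral_frullani_exp hp hq]
    exact Real.log_nonneg ((one_le_div hp).2 hpq)

/-- The integral over all scales of the heat kernel, weighted by `1 / a`. -/
lemma integral_heat_kernel {t : ℝ} (ht : t ≠ 0) :
    ∫ a in Ioi (0 : ℝ), a ^ (-3 / 2 : ℝ) * Real.exp (-(π * t ^ 2 * a⁻¹)) = |t|⁻¹ := by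
  have hr : 0 < π * t ^ 2 := by positivity
  have h := integral_comp_rpow_Ioi
    (fun y : ℝ => y ^ ((1 / 2 : ℝ) - 1) * Real.exp (-(π * t ^ 2 * y))) (p := -1) (by norm_num)
  rw [Real.integral_rpow_mul_exp_neg_mul_Ioi (by norm_num) hr, Real.Gamma_one_half_eq,
    ← Real.sqrt_eq_rpow, one_div (π * t ^ 2), Real.sqrt_inv, Real.sqrt_mul Real.pi_pos.le,
    Real.sqrt_sq_eq_abs] at h
  have hpi : √π ≠ 0 := by positivity
  rw [mul_inv, mul_right_comm, inv_mul_cancel₀ hpi, one_mul] at h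
  rw [← h]
  refine setIntegral_congr_fun measurableSet_Ioi fun a ha => ?_
  have ha : 0 < a := ha
  simp only [abs_neg, abs_one, one_mul, smul_eq_mul, Real.rpow_neg_one]
  rw [← Real.rpow_neg_one a, ← Real.rpow_mul ha.le, ← mul_assoc, ← Real.rpow_add ha]
  norm_num

lemma integrableOn_heat_kernel {t : ℝ} (ht : t ≠ 0) :
    IntegrableOn (fun a : ℝ => a ^ (-3 / 2 : ℝ) * Real.exp (-(π * t ^ 2 * a⁻¹))) (Ioi 0) :=
  Integrable.of_integral_ne_zero (by rw [integral_heat_kernel ht]; positivity)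

/-- Multiplication formula for the Fourier transform against a Gaussian. -/
lemma integral_gaussian_mul_fourier {ψ : ℝ → ℂ} (hψ : Integrable ψ) {a : ℝ} (ha : 0 < a) :
    ∫ x : ℝ, (Real.exp (-(π * x ^ 2 * a)) : ℂ) * 𝓕 ψ x
      = ∫ t : ℝ, ((a ^ (-1 / 2 : ℝ) * Real.exp (-(π * t ^ 2 * a⁻¹)) : ℝ) : ℂ) * ψ t := by
  have hgint : Integrable fun x : ℝ => cexp (-π * a * x ^ 2) := by
    have := (integrable_exp_neg_mul_sq (mul_pos Real.pi_pos ha)).ofReal (𝕜 := ℂ)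
    refine this.congr (Eventually.of_forall fun x => ?_)
    change ((Real.exp (-(π * a) * x ^ 2) : ℝ) : ℂ) = cexp (-π * a * x ^ 2)
    push_cast
    ring_nf
  have hflip : ∫ x : ℝ, 𝓕 ψ x • cexp (-π * a * x ^ 2)
      = ∫ t : ℝ, ψ t • 𝓕 (fun x : ℝ => cexp (-π * a * x ^ 2)) t := by
    simpa using! VectorFourier.integral_fourierIntegral_smul_eq_flip (L := innerₗ ℝ)
      Real.continuous_fourierChar continuous_inner hψ hgint
  rw [fourier_gaussian_pi (by simpa using ha)] at hflip
  calc ∫ x : ℝ, (Real.exp (-(π * x ^ 2 * a)) : ℂ) * 𝓕 ψ x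
      = ∫ x : ℝ, 𝓕 ψ x • cexp (-π * a * x ^ 2) := by
        congr 1 with x
        rw [smul_eq_mul, mul_comm]
        push_cast
        ring_nf
    _ = _ := by
        rw [hflip]
        congr 1 with t
        have hpow : 1 / (a : ℂ) ^ (1 / 2 : ℂ) = ((a ^ (-1 / 2 : ℝ) : ℝ) : ℂ) := by
          rw [ofReal_cpow ha.le, one_div, ← cpow_neg]
          push_cast
          ring_nf
        rw [hpow, smul_eq_mul, mul_comm]
        push_cast
        ring_nf

lemma integral_fourier_eq_apply_zero {ψ : ℝ → ℂ} (hc : Continuous ψ) (hi : Integrable ψ)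
    (hF : Integrable (𝓕 ψ)) : ∫ x, 𝓕 ψ x = ψ 0 := by
  have h := congrFun (hc.fourierInv_fourier_eq hi hF) 0
  rw [Real.fourierInv_eq] at h
  simpa using h

lemma neg_log_abs_eq_integral {x : ℝ} (hx : x ≠ 0) :
    ∫ a in Ioi (0 : ℝ), 2⁻¹ * (a⁻¹ * (Real.exp (-(π * x ^ 2 * a)) - Real.exp (-(π * a))))
      = -Real.log |x| := by
  have hx2 : 0 < π * x ^ 2 := by positivity
  rw [integral_const_mul, integral_frullani_exp hx2 Real.pi_pos,
    div_mul_cancel_left₀ Real.pi_ne_zero, Real.log_inv, Real.log_pow, Real.log_abs]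
  push_cast
  ring

lemma integrable_frullani_kernel_mul {F : ℝ → ℂ} (hF : AEStronglyMeasurable F)
    (hlog : Integrable fun x : ℝ => ((-Real.log |x| : ℝ) : ℂ) * F x) :
    Integrable (Function.uncurry fun x a : ℝ =>
      ((2⁻¹ * (a⁻¹ * (Real.exp (-(π * x ^ 2 * a)) - Real.exp (-(π * a)))) : ℝ) : ℂ) * F x)
      (volume.prod (volume.restrict (Ioi 0))) := by
  have hmeas : Measurable fun p : ℝ × ℝ =>
      ((2⁻¹ * (p.2⁻¹ * (Real.exp (-(π * p.1 ^ 2 * p.2)) - Real.exp (-(π * p.2)))) : ℝ) : ℂ) := by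
    fun_prop
  have hne : ∀ᵐ x : ℝ, x ≠ 0 := Measure.ae_ne volume 0
  have hmeas' : AEStronglyMeasurable (Function.uncurry fun x a : ℝ =>
      ((2⁻¹ * (a⁻¹ * (Real.exp (-(π * x ^ 2 * a)) - Real.exp (-(π * a)))) : ℝ) : ℂ) * F x)
      (volume.prod (volume.restrict (Ioi 0))) := hmeas.aestronglyMeasurable.mul hF.comp_fst
  refine (integrable_prod_iff hmeas').2 ⟨?_, ?_⟩
  · filter_upwards [hne] with x hx
    have h := (integrableOn_frullani_exp (by positivity : 0 < π * x ^ 2) Real.pi_pos).const_mul 2⁻¹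
    exact (Integrable.ofReal (𝕜 := ℂ) h).mul_const (F x)
  · refine hlog.norm.congr ?_
    filter_upwards [hne] with x hx
    have hx2 : 0 < π * x ^ 2 := by positivity
    simp only [Function.uncurry_apply_pair, norm_mul, norm_real]
    rw [integral_mul_const]
    congr 1
    simp_rw [← norm_mul, norm_mul (2⁻¹ : ℝ), Real.norm_eq_abs]
    rw [integral_const_mul, integral_abs_frullani_exp hx2 Real.pi_pos,
      ← neg_log_abs_eq_integral hx, integral_const_mul, integral_frullani_exp hx2 Real.pi_pos,
      abs_mul]

lemma integrable_heat_kernel_mul {ψ : ℝ → ℂ} (hψ : AEStronglyMeasurable ψ)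
    (hdiv : Integrable fun t : ℝ => ψ t / ((2 * |t| : ℝ) : ℂ)) :
    Integrable (Function.uncurry fun t a : ℝ =>
      ((2⁻¹ * (a ^ (-3 / 2 : ℝ) * Real.exp (-(π * t ^ 2 * a⁻¹))) : ℝ) : ℂ) * ψ t)
      (volume.prod (volume.restrict (Ioi 0))) := by
  have hmeas : Measurable fun p : ℝ × ℝ =>
      ((2⁻¹ * (p.2 ^ (-3 / 2 : ℝ) * Real.exp (-(π * p.1 ^ 2 * p.2⁻¹))) : ℝ) : ℂ) := by
    fun_prop
  have hne : ∀ᵐ t : ℝ, t ≠ 0 := Measure.ae_ne volume 0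
  have hmeas' : AEStronglyMeasurable (Function.uncurry fun t a : ℝ =>
      ((2⁻¹ * (a ^ (-3 / 2 : ℝ) * Real.exp (-(π * t ^ 2 * a⁻¹))) : ℝ) : ℂ) * ψ t)
      (volume.prod (volume.restrict (Ioi 0))) := hmeas.aestronglyMeasurable.mul hψ.comp_fst
  refine (integrable_prod_iff hmeas').2 ⟨?_, ?_⟩
  · filter_upwards [hne] with t ht
    have h := (integrableOn_heat_kernel ht).const_mul 2⁻¹
    exact (Integrable.ofReal (𝕜 := ℂ) h).mul_const (ψ t)
  · refine hdiv.norm.congr ?_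
    filter_upwards [hne] with t ht
    simp only [Function.uncurry_apply_pair, norm_mul, norm_real]
    rw [integral_mul_const, integral_const_mul]
    have habs : ∫ a in Ioi (0 : ℝ), ‖a ^ (-3 / 2 : ℝ)‖ * ‖Real.exp (-(π * t ^ 2 * a⁻¹))‖
        = |t|⁻¹ := by
      rw [← integral_heat_kernel ht]
      refine setIntegral_congr_fun measurableSet_Ioi fun a ha => ?_
      have ha : 0 < a := ha
      simp only [Real.norm_eq_abs, Real.abs_exp, abs_of_pos (Real.rpow_pos_of_pos ha _)]
    rw [habs, norm_div, norm_real]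
    simp only [norm_mul, norm_inv, Real.norm_eq_abs, abs_abs]
    field_simp

/-- For functions vanishing at the origin no regularisation of `1 / (2|t|)` is needed. -/
lemma integral_neg_log_abs_mul_fourier {ψ : ℝ → ℂ} (hc : Continuous ψ) (hi : Integrable ψ)
    (h0 : ψ 0 = 0) (hF : Integrable (𝓕 ψ))
    (hlog : Integrable fun x : ℝ => ((-Real.log |x| : ℝ) : ℂ) * 𝓕 ψ x)
    (hdiv : Integrable fun t : ℝ => ψ t / ((2 * |t| : ℝ) : ℂ)) :
    ∫ x : ℝ, ((-Real.log |x| : ℝ) : ℂ) * 𝓕 ψ x = ∫ t : ℝ, ψ t / ((2 * |t| : ℝ) : ℂ) := by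
  have hscale : ∀ a ∈ Ioi (0 : ℝ),
      ∫ x : ℝ, ((2⁻¹ * (a⁻¹ * (Real.exp (-(π * x ^ 2 * a)) - Real.exp (-(π * a)))) : ℝ) : ℂ)
          * 𝓕 ψ x
        = ∫ t : ℝ, ((2⁻¹ * (a ^ (-3 / 2 : ℝ) * Real.exp (-(π * t ^ 2 * a⁻¹))) : ℝ) : ℂ)
          * ψ t := by
    intro a ha
    have ha : 0 < a := ha
    have hgF : Integrable fun x : ℝ => (Real.exp (-(π * x ^ 2 * a)) : ℂ) * 𝓕 ψ x := by
      refine hF.bdd_mul (c := 1)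
        (by fun_prop : Continuous fun x : ℝ => (Real.exp (-(π * x ^ 2 * a)) : ℂ)).aestronglyMeasurable
        (Eventually.of_forall fun x => ?_)
      rw [norm_real, Real.norm_eq_abs, Real.abs_exp, Real.exp_le_one_iff]
      have : 0 ≤ π * x ^ 2 * a := by positivity
      linarith
    have hpow : a ^ (-3 / 2 : ℝ) = a⁻¹ * a ^ (-1 / 2 : ℝ) := by
      rw [← Real.rpow_neg_one, ← Real.rpow_add ha]
      norm_num
    calc _ = ∫ x : ℝ, ((2⁻¹ * a⁻¹ : ℝ) : ℂ) * ((Real.exp (-(π * x ^ 2 * a)) : ℂ) * 𝓕 ψ x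
            - (Real.exp (-(π * a)) : ℂ) * 𝓕 ψ x) := by
          congr 1 with x
          push_cast
          ring
      _ = ((2⁻¹ * a⁻¹ : ℝ) : ℂ)
            * ∫ t : ℝ, ((a ^ (-1 / 2 : ℝ) * Real.exp (-(π * t ^ 2 * a⁻¹)) : ℝ) : ℂ) * ψ t := by
          rw [integral_const_mul, integral_sub hgF (hF.const_mul _), integral_const_mul,
            integral_fourier_eq_apply_zero hc hi hF, h0, mul_zero, sub_zero,
            integral_gaussian_mul_fourier hi ha]
      _ = _ := by
          rw [← integral_const_mul]
          congr 1 with t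
          rw [hpow]
          push_cast
          ring
  calc ∫ x : ℝ, ((-Real.log |x| : ℝ) : ℂ) * 𝓕 ψ x
      = ∫ x : ℝ, ∫ a in Ioi (0 : ℝ),
          ((2⁻¹ * (a⁻¹ * (Real.exp (-(π * x ^ 2 * a)) - Real.exp (-(π * a)))) : ℝ) : ℂ)
            * 𝓕 ψ x := by
        refine integral_congr_ae ?_
        filter_upwards [Measure.ae_ne volume (0 : ℝ)] with x hx
        rw [integral_mul_const, integral_complex_ofReal, neg_log_abs_eq_integral hx]
    _ = ∫ a in Ioi (0 : ℝ), ∫ t : ℝ,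
          ((2⁻¹ * (a ^ (-3 / 2 : ℝ) * Real.exp (-(π * t ^ 2 * a⁻¹))) : ℝ) : ℂ) * ψ t := by
        rw [integral_integral_swap (integrable_frullani_kernel_mul hF.aestronglyMeasurable hlog)]
        exact setIntegral_congr_fun measurableSet_Ioi hscale
    _ = ∫ t : ℝ, ψ t / ((2 * |t| : ℝ) : ℂ) := by
        rw [← integral_integral_swap (integrable_heat_kernel_mul hi.aestronglyMeasurable hdiv)]
        refine integral_congr_ae ?_
        filter_upwards [Measure.ae_ne volume (0 : ℝ)] with t ht
        rw [integral_mul_const, integral_complex_ofReal, integral_const_mul, integral_heat_kernel ht]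
        push_cast
        rw [div_eq_mul_inv, mul_inv, mul_comm]

lemma mellin_gaussian_pi {s : ℂ} (hs : 0 < s.re) :
    mellin (fun t : ℝ => (Real.exp (-π * t ^ 2) : ℂ)) s = 2⁻¹ * Gammaℝ s := by
  have h := mellin_comp_rpow (fun t : ℝ => cexp (-(π * t))) s 2
  have hG : mellin (fun t : ℝ => cexp (-(π * t))) (s / 2) = Gammaℝ s := by
    simp only [mellin, smul_eq_mul]
    rw [integral_cpow_mul_exp_neg_mul_Ioi (by simpa using hs) Real.pi_pos, Gammaℝ_def, one_div,
      inv_cpow _ _ (by rw [arg_ofReal_of_nonneg Real.pi_pos.le]; exact Real.pi_pos.ne),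
      ← cpow_neg, neg_div]
  rw [ofReal_ofNat, hG, abs_two] at h
  rw [show (fun t : ℝ => (Real.exp (-π * t ^ 2) : ℂ)) = fun t : ℝ => cexp (-(π * (t ^ (2 : ℝ) : ℝ)))
    by ext t; push_cast [Real.rpow_two]; ring_nf, h, real_smul]
  push_cast
  rfl

lemma hasDerivAt_mellin_gaussian_pi {s : ℂ} (hs : 0 < s.re) :
    MellinConvergent (fun t : ℝ => Real.log t • (Real.exp (-π * t ^ 2) : ℂ)) s ∧
      HasDerivAt (mellin fun t : ℝ => (Real.exp (-π * t ^ 2) : ℂ))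
        (mellin (fun t : ℝ => Real.log t • (Real.exp (-π * t ^ 2) : ℂ)) s) s := by
  have hcont : Continuous fun t : ℝ => (Real.exp (-π * t ^ 2) : ℂ) := by fun_prop
  refine mellin_hasDerivAt_of_isBigO_rpow (a := s.re + 1) (b := 0)
    (hcont.locallyIntegrable.locallyIntegrableOn _) ?_ (by linarith) ?_ hs
  · have h := (rexp_neg_quadratic_isLittleO_rpow_atTop (neg_lt_zero.2 Real.pi_pos) 0
      (-(s.re + 1))).isBigO
    refine Asymptotics.IsBigO.of_norm_left ?_
    simpa only [norm_real, zero_mul, add_zero] using h.norm_left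
  · simp only [neg_zero, Real.rpow_zero]
    exact ((hcont.tendsto 0).mono_left nhdsWithin_le_nhds).isBigO_one ℝ

lemma integral_log_mul_gaussian_of_hasDerivAt {s d : ℂ} (hs : 0 < s.re)
    (hd : HasDerivAt Gammaℝ d s) :
    mellin (fun t : ℝ => Real.log t • (Real.exp (-π * t ^ 2) : ℂ)) s = 2⁻¹ * d := by
  refine (hasDerivAt_mellin_gaussian_pi hs).2.unique ?_
  refine (hd.const_mul 2⁻¹).congr_of_eventuallyEq ?_
  filter_upwards [continuous_re.continuousAt.eventually_const_lt hs] with z hz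
  exact mellin_gaussian_pi hz

lemma hasDerivAt_Gammaℝ_two :
    HasDerivAt Gammaℝ (((-(Real.eulerMascheroniConstant + Real.log π) / (2 * π) : ℝ)) : ℂ) 2 := by
  have hpow : HasDerivAt (fun s : ℂ => (π : ℂ) ^ (-s / 2))
      ((π : ℂ) ^ (-2 / 2 : ℂ) * Complex.log π * (-1 / 2)) 2 :=
    ((hasDerivAt_neg (2 : ℂ)).div_const 2).const_cpow (Or.inl (by simp [Real.pi_ne_zero]))
  have hΓ : HasDerivAt (fun s : ℂ => Gamma (s / 2))
      (-(Real.eulerMascheroniConstant : ℂ) * (1 / 2)) 2 := by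
    refine HasDerivAt.comp (h := fun s : ℂ => s / 2) 2 ?_ ((hasDerivAt_id (2 : ℂ)).div_const 2)
    simpa using hasDerivAt_Gamma_one
  refine (hpow.mul hΓ).congr_deriv ?_
  have hpi : (π : ℂ) ≠ 0 := by simp [Real.pi_ne_zero]
  rw [neg_div, div_self two_ne_zero, Gamma_one, cpow_neg_one, ← ofReal_log Real.pi_pos.le]
  push_cast
  field_simp
  ring

lemma integral_log_mul_gaussian :
    ∫ t in Ioi (0 : ℝ), Real.log t * Real.exp (-π * t ^ 2)
      = -(Real.eulerMascheroniConstant + Real.log (4 * π)) / 4 := by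
  have h := integral_log_mul_gaussian_of_hasDerivAt (s := 1) (by simp) hasDerivAt_Gammaℝ_one
  simp only [mellin, sub_self, cpow_zero, one_smul, real_smul, ← ofReal_mul] at h
  rw [integral_complex_ofReal] at h
  rw [← ofReal_inj, h, show Complex.log (4 * π) = ((Real.log (4 * π) : ℝ) : ℂ) by
    rw [ofReal_log (by positivity)]; push_cast; rfl]
  push_cast
  ring

lemma integral_mul_log_mul_gaussian :
    ∫ t in Ioi (0 : ℝ), t * (Real.log t * Real.exp (-π * t ^ 2))
      = -(Real.eulerMascheroniConstant + Real.log π) / (4 * π) := by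
  have h := integral_log_mul_gaussian_of_hasDerivAt (s := 2) (by simp) hasDerivAt_Gammaℝ_two
  simp only [mellin, show (2 : ℂ) - 1 = 1 by norm_num, cpow_one, smul_eq_mul, real_smul,
    ← ofReal_mul] at h
  rw [integral_complex_ofReal] at h
  rw [← ofReal_inj, h]
  push_cast
  ring

lemma integrableOn_mul_log_mul_gaussian :
    IntegrableOn (fun t : ℝ => t * (Real.log t * Real.exp (-π * t ^ 2))) (Ioi 0) := by
  have h := (hasDerivAt_mellin_gaussian_pi (s := 2) (by simp)).1
  simp only [MellinConvergent, show (2 : ℂ) - 1 = 1 by norm_num, cpow_one, smul_eq_mul, real_smul,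
    ← ofReal_mul] at h
  exact h.re

lemma abs_exp_neg_pi_sq_sub_one_le (t : ℝ) : |Real.exp (-π * t ^ 2) - 1| ≤ π * t ^ 2 := by
  have h1 := Real.add_one_le_exp (-π * t ^ 2)
  have h2 : Real.exp (-π * t ^ 2) ≤ 1 := by
    rw [Real.exp_le_one_iff, neg_mul, neg_nonpos]
    positivity
  rw [abs_le]
  constructor <;> nlinarith [Real.pi_pos, sq_nonneg t, mul_nonneg Real.pi_pos.le (sq_nonneg t)]

lemma hasDerivAt_gaussian_sub_mul_log (c : ℝ) {t : ℝ} (ht : 0 < t) :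
    HasDerivAt (fun t : ℝ => (Real.exp (-π * t ^ 2) - c) * Real.log t)
      ((Real.exp (-π * t ^ 2) - c) / t
        - 2 * π * (t * (Real.log t * Real.exp (-π * t ^ 2)))) t := by
  have h1 : HasDerivAt (fun t : ℝ => Real.exp (-π * t ^ 2) - c)
      (Real.exp (-π * t ^ 2) * (-π * (2 * t))) t := by
    simpa using! (((hasDerivAt_pow 2 t).const_mul (-π)).exp.sub_const c)
  refine (h1.mul (Real.hasDerivAt_log ht.ne')).congr_deriv ?_
  field_simp
  ring

lemma continuousOn_gaussian_sub_one_mul_log :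
    ContinuousOn (fun t : ℝ => (Real.exp (-π * t ^ 2) - 1) * Real.log t) (Icc 0 1) := by
  intro t ht
  rcases ht.1.eq_or_lt with rfl | ht0
  · refine ContinuousAt.continuousWithinAt ?_
    rw [ContinuousAt, Real.log_zero, mul_zero]
    have hb : Tendsto (fun t : ℝ => π * |t| * |t * Real.log t|) (𝓝 0) (𝓝 0) := by
      have hc : Continuous fun t : ℝ => π * |t| * |t * Real.log t| :=
        (continuous_const.mul continuous_abs).mul Real.continuous_mul_log.abs
      simpa using hc.tendsto 0
    refine squeeze_zero_norm (fun t => ?_) hb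
    rw [norm_mul, Real.norm_eq_abs, Real.norm_eq_abs, abs_mul t,
      show π * |t| * (|t| * |Real.log t|) = π * |t| ^ 2 * |Real.log t| by ring, sq_abs]
    gcongr
    exact abs_exp_neg_pi_sq_sub_one_le t
  · exact (hasDerivAt_gaussian_sub_mul_log 1 ht0).continuousAt.continuousWithinAt

lemma integrableOn_gaussian_sub_one_div :
    IntegrableOn (fun t : ℝ => (Real.exp (-π * t ^ 2) - 1) / t) (Ioc 0 1) := by
  refine Measure.integrableOn_of_bounded (M := π) measure_Ioc_lt_top.ne
    (Measurable.aestronglyMeasurable (by fun_prop)) ?_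
  refine (ae_restrict_iff' measurableSet_Ioc).2 (Eventually.of_forall fun t ht => ?_)
  have ht0 : 0 < t := ht.1
  rw [norm_div, Real.norm_eq_abs, Real.norm_of_nonneg ht0.le, div_le_iff₀ ht0]
  have h1 : t ^ 2 ≤ t := by nlinarith [ht.2]
  exact (abs_exp_neg_pi_sq_sub_one_le t).trans (by gcongr)

lemma integrableOn_gaussian_div :
    IntegrableOn (fun t : ℝ => Real.exp (-π * t ^ 2) / t) (Ioi 1) := by
  refine Integrable.mono (integrable_exp_neg_mul_sq Real.pi_pos).integrableOn
    (Measurable.aestronglyMeasurable (by fun_prop)) ?_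
  refine (ae_restrict_iff' measurableSet_Ioi).2 (Eventually.of_forall fun t ht => ?_)
  have ht1 : 1 < t := ht
  rw [norm_div, Real.norm_of_nonneg (by linarith : 0 ≤ t)]
  exact div_le_self (norm_nonneg _) ht1.le

lemma tendsto_gaussian_mul_log :
    Tendsto (fun t : ℝ => Real.exp (-π * t ^ 2) * Real.log t) atTop (𝓝 0) := by
  have h := (rexp_neg_quadratic_isLittleO_rpow_atTop (neg_lt_zero.2 Real.pi_pos) 0 (-1)).mul
    (Real.isLittleO_log_id_atTop)
  simp only [zero_mul, add_zero, id] at h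
  refine (Asymptotics.isLittleO_one_iff ℝ).1 (h.trans_eventuallyEq ?_)
  filter_upwards [eventually_gt_atTop 0] with t ht
  rw [Real.rpow_neg_one, inv_mul_cancel₀ ht.ne']

/-- The finite part of `∫ exp(-πt²) dt / t` over the half line. -/
lemma integral_gaussian_div_finite_part :
    (∫ t in Ioc (0 : ℝ) 1, (Real.exp (-π * t ^ 2) - 1) / t)
        + ∫ t in Ioi (1 : ℝ), Real.exp (-π * t ^ 2) / t
      = -(Real.eulerMascheroniConstant + Real.log π) / 2 := by
  have hM : IntegrableOn (fun t : ℝ => 2 * π * (t * (Real.log t * Real.exp (-π * t ^ 2))))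
      (Ioi 0) := integrableOn_mul_log_mul_gaussian.const_mul (2 * π)
  have hM1 := hM.mono_set (Ioc_subset_Ioi_self : Ioc (0 : ℝ) 1 ⊆ Ioi 0)
  have hM2 := hM.mono_set (Ioi_subset_Ioi (zero_le_one (α := ℝ)))
  have h1 := intervalIntegral.integral_eq_sub_of_hasDerivAt_of_le zero_le_one
    continuousOn_gaussian_sub_one_mul_log
    (fun t ht => hasDerivAt_gaussian_sub_mul_log 1 ht.1)
    ((intervalIntegrable_iff_integrableOn_Ioc_of_le zero_le_one).2
      (integrableOn_gaussian_sub_one_div.sub hM1))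
  have h2 := integral_Ioi_of_hasDerivAt_of_tendsto' (a := 1)
    (fun t ht => hasDerivAt_gaussian_sub_mul_log 0 (zero_lt_one.trans_le ht))
    (by simpa only [sub_zero, ← Pi.sub_def] using integrableOn_gaussian_div.sub hM2)
    (by simpa only [sub_zero] using tendsto_gaussian_mul_log)
  rw [intervalIntegral.integral_of_le zero_le_one,
    integral_sub integrableOn_gaussian_sub_one_div hM1] at h1
  simp only [sub_zero] at h2
  rw [integral_sub integrableOn_gaussian_div hM2] at h2
  have h3 := setIntegral_union Ioc_disjoint_Ioi_same measurableSet_Ioi hM1 hM2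
  rw [Ioc_union_Ioi_eq_Ioi zero_le_one, integral_const_mul, integral_mul_log_mul_gaussian] at h3
  simp only [Real.log_one, Real.log_zero, mul_zero, sub_zero] at h1 h2
  have h4 : 2 * π * (-(Real.eulerMascheroniConstant + Real.log π) / (4 * π))
      = -(Real.eulerMascheroniConstant + Real.log π) / 2 := by
    field_simp
    ring
  linarith

lemma setIntegral_comp_abs {s : Set ℝ} (hs : MeasurableSet s) (hs0 : s ⊆ Ioi 0) (f : ℝ → ℝ) :
    ∫ t in {t : ℝ | |t| ∈ s}, f |t| = 2 * ∫ t in s, f t := by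
  have hs' : MeasurableSet {t : ℝ | |t| ∈ s} := measurable_norm hs
  have h := integral_comp_abs (f := s.indicator f)
  rw [setIntegral_indicator hs, inter_eq_self_of_subset_right hs0] at h
  rw [← h, ← integral_indicator hs']
  rfl

lemma integral_neg_log_abs_mul_gaussian :
    ∫ x : ℝ, ((-Real.log |x| : ℝ) : ℂ) * (Real.exp (-π * x ^ 2) : ℂ)
      = (((Real.eulerMascheroniConstant + Real.log (4 * π)) / 2 : ℝ) : ℂ) := by
  have h := integral_comp_abs (f := fun x : ℝ => Real.log x * Real.exp (-π * x ^ 2))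
  simp only [sq_abs] at h
  rw [integral_log_mul_gaussian] at h
  simp only [← ofReal_mul, neg_mul (Real.log _)]
  rw [integral_complex_ofReal, integral_neg, h]
  congr 1
  ring

lemma integral_gaussian_div_abs_finite_part :
    (∫ t in {t : ℝ | 0 < |t| ∧ |t| ≤ 1},
          ((Real.exp (-π * t ^ 2) : ℂ) - 1) / ((2 * |t| : ℝ) : ℂ))
        + ∫ t in {t : ℝ | 1 < |t|}, (Real.exp (-π * t ^ 2) : ℂ) / ((2 * |t| : ℝ) : ℂ)
      = ((-(Real.eulerMascheroniConstant + Real.log π) / 2 : ℝ) : ℂ) := by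
  have hA := setIntegral_comp_abs (measurableSet_Ioc (a := (0 : ℝ)) (b := 1)) Ioc_subset_Ioi_self
    fun t => (Real.exp (-π * t ^ 2) - 1) / (2 * t)
  have hB := setIntegral_comp_abs (measurableSet_Ioi (a := (1 : ℝ)))
    (Ioi_subset_Ioi zero_le_one) fun t => Real.exp (-π * t ^ 2) / (2 * t)
  simp only [sq_abs, mem_Ioc, mem_Ioi, mul_comm (2 : ℝ) (_ : ℝ), ← div_div, integral_div] at hA hB
  simp only [← ofReal_one, ← ofReal_sub, ← ofReal_div, integral_complex_ofReal, ← ofReal_add]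
  rw [← integral_gaussian_div_finite_part]
  simp only [mul_comm (2 : ℝ) (_ : ℝ), ← div_div, integral_div]
  congr 1
  linarith

lemma integrable_mul_schwartzMap (f : SchwartzMap ℝ ℂ) :
    Integrable fun x : ℝ => (x : ℂ) * f x := by
  refine (f.integrable_pow_mul volume 1).mono
    ((continuous_ofReal.mul f.continuous).aestronglyMeasurable) (Eventually.of_forall fun x => ?_)
  simp

lemma exists_norm_sub_apply_zero_le (f : SchwartzMap ℝ ℂ) :
    ∃ C : ℝ, ∀ t : ℝ, ‖f t - f 0‖ ≤ C * |t| := by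
  obtain ⟨C, -, hC⟩ := f.decay 0 1
  refine ⟨C, fun t => ?_⟩
  have h := convex_univ.norm_image_sub_le_of_norm_deriv_le (𝕜 := ℝ) (f := f) (C := C)
    (fun x _ => f.differentiableAt) (fun x _ => ?_) (mem_univ 0) (mem_univ t)
  · simpa using h
  · simpa [norm_iteratedFDeriv_eq_norm_iteratedDeriv, iteratedDeriv_one] using hC x

lemma fourier_sub_const_mul {f g : ℝ → ℂ} (hf : Integrable f) (hg : Integrable g) (c : ℂ) (x : ℝ) :
    𝓕 (fun t => f t - c * g t) x = 𝓕 f x - c * 𝓕 g x := by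
  simp only [Real.fourier_eq, smul_sub, ← mul_smul_comm]
  rw [integral_sub ((Real.fourierIntegral_convergent_iff x).2 hf)
    (((Real.fourierIntegral_convergent_iff x).2 hg).const_mul c), integral_const_mul]

lemma fourier_exp_neg_pi_mul_sq :
    𝓕 (fun t : ℝ => (Real.exp (-π * t ^ 2) : ℂ)) = fun t : ℝ => (Real.exp (-π * t ^ 2) : ℂ) := by
  have h := fourier_gaussian_pi (b := 1) (by simp)
  simpa using h

lemma integral_eq_add_setIntegral_abs {f : ℝ → ℂ}
    (hA : IntegrableOn f {t : ℝ | 0 < |t| ∧ |t| ≤ 1}) (hB : IntegrableOn f {t : ℝ | 1 < |t|}) :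
    Integrable f ∧ ∫ t, f t
      = (∫ t in {t : ℝ | 0 < |t| ∧ |t| ≤ 1}, f t) + ∫ t in {t : ℝ | 1 < |t|}, f t := by
  have huniv : ({t : ℝ | 0 < |t| ∧ |t| ≤ 1} ∪ {t : ℝ | 1 < |t|} : Set ℝ)
      =ᵐ[volume] (univ : Set ℝ) := by
    refine eventuallyEq_univ.2 ?_
    filter_upwards [Measure.ae_ne volume (0 : ℝ)] with t ht
    exact (le_or_gt |t| 1).imp (fun h => ⟨abs_pos.2 ht, h⟩) id
  have hdisj : Disjoint {t : ℝ | 0 < |t| ∧ |t| ≤ 1} {t : ℝ | 1 < |t|} :=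
    disjoint_left.2 fun t h1 h2 => h1.2.not_gt h2
  constructor
  · rw [← integrableOn_univ]
    exact (hA.union hB).congr_set_ae huniv.symm
  · rw [← setIntegral_union hdisj measurableSet_one_lt_abs hA hB, setIntegral_congr_set huniv,
      setIntegral_univ]

/-- **The Fourier transform of `-log|x|` on `ℝ`.**  For every Schwartz function `φ`,
`∫_ℝ (-log|x|)·(𝓕φ)(x) dx = ∫_{0<|t|≤1} (φ(t)-φ(0)) dt/(2|t|) + ∫_{|t|>1} φ(t) dt/(2|t|)
 + (log 2π + γ)·φ(0)`. -/
theorem fourier_transform_of_neg_log_abs (φ : SchwartzMap ℝ ℂ) :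
    (∫ x : ℝ, ((-Real.log |x| : ℝ) : ℂ) * 𝓕 (⇑φ) x)
      = (∫ t in {t : ℝ | 0 < |t| ∧ |t| ≤ 1}, (φ t - φ 0) / ((2 * |t| : ℝ) : ℂ))
          + (∫ t in {t : ℝ | 1 < |t|}, φ t / ((2 * |t| : ℝ) : ℂ))
          + ((Real.log (2 * π) + Real.eulerMascheroniConstant : ℝ) : ℂ) * φ 0 := by
  set c : ℂ := φ 0 with hc
  set g : ℝ → ℂ := fun t => (Real.exp (-π * t ^ 2) : ℂ) with hg
  have hg0 : g 0 = 1 := by simp [hg]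
  have hgc : Continuous g := by fun_prop
  have hgi : Integrable g := Integrable.ofReal (integrable_exp_neg_mul_sq Real.pi_pos)
  have hxg : Integrable fun x : ℝ => (x : ℂ) * g x := by
    have h := Integrable.ofReal (𝕜 := ℂ) (integrable_mul_exp_neg_mul_sq Real.pi_pos)
    refine h.congr (Eventually.of_forall fun x => ?_)
    exact ofReal_mul _ _
  have hFg : 𝓕 g = g := fourier_exp_neg_pi_mul_sq
  have hFφ : ⇑(𝓕 φ : SchwartzMap ℝ ℂ) = 𝓕 (⇑φ) := SchwartzMap.fourier_coe φ
  have hFφc : Continuous (𝓕 (⇑φ)) := hFφ ▸ (𝓕 φ : SchwartzMap ℝ ℂ).continuous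
  have hFφi : Integrable (𝓕 (⇑φ)) := hFφ ▸ (𝓕 φ : SchwartzMap ℝ ℂ).integrable
  have hφlog := integrable_neg_log_abs_mul hFφc
    (hFφ ▸ integrable_mul_schwartzMap (𝓕 φ : SchwartzMap ℝ ℂ))
  have hglog := integrable_neg_log_abs_mul hgc hxg
  have hFψ : 𝓕 (fun t => φ t - c * g t) = fun x => 𝓕 (⇑φ) x - c * g x := by
    ext x
    rw [fourier_sub_const_mul φ.integrable hgi, hFg]
  have hlog_sub : (fun x : ℝ => ((-Real.log |x| : ℝ) : ℂ) * 𝓕 (fun t => φ t - c * g t) x)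
      = fun x => ((-Real.log |x| : ℝ) : ℂ) * 𝓕 (⇑φ) x - c * (((-Real.log |x| : ℝ) : ℂ) * g x) := by
    ext x
    rw [hFψ]
    ring
  obtain ⟨C, hC⟩ := exists_norm_sub_apply_zero_le φ
  have hφA := integrableOn_sub_div_two_mul_abs φ.continuous fun t _ => hC t
  have hφB := integrableOn_div_two_mul_abs φ.continuous φ.integrable
  have hgA : IntegrableOn (fun t : ℝ => (g t - 1) / ((2 * |t| : ℝ) : ℂ))
      {t : ℝ | 0 < |t| ∧ |t| ≤ 1} := by
    rw [← hg0]
    refine integrableOn_sub_div_two_mul_abs hgc (C := π) fun t ht => ?_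
    rw [hg0, hg, ← ofReal_one, ← ofReal_sub, norm_real, ← sq_abs]
    have h := abs_exp_neg_pi_sq_sub_one_le |t|
    refine h.trans ?_
    gcongr
    nlinarith [abs_nonneg t]
  have hgB := integrableOn_div_two_mul_abs hgc hgi
  have hA_eq : (fun t : ℝ => (φ t - c * g t) / ((2 * |t| : ℝ) : ℂ))
      = fun t => (φ t - c) / ((2 * |t| : ℝ) : ℂ) - c * ((g t - 1) / ((2 * |t| : ℝ) : ℂ)) := by
    ext t
    ring
  have hB_eq : (fun t : ℝ => (φ t - c * g t) / ((2 * |t| : ℝ) : ℂ))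
      = fun t => φ t / ((2 * |t| : ℝ) : ℂ) - c * (g t / ((2 * |t| : ℝ) : ℂ)) := by
    ext t
    ring
  obtain ⟨hdiv, hsplit⟩ := integral_eq_add_setIntegral_abs
    (f := fun t : ℝ => (φ t - c * g t) / ((2 * |t| : ℝ) : ℂ))
    (hA_eq ▸ hφA.sub (hgA.const_mul c)) (hB_eq ▸ hφB.sub (hgB.const_mul c))
  have hmain := integral_neg_log_abs_mul_fourier (ψ := fun t => φ t - c * g t)
    (φ.continuous.sub (continuous_const.mul hgc)) (φ.integrable.sub (hgi.const_mul c))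
    (by rw [hg0, ← hc, mul_one, sub_self]) (hFψ ▸ hFφi.sub (hgi.const_mul c))
    (hlog_sub ▸ hφlog.sub (hglog.const_mul c)) hdiv
  rw [hlog_sub, integral_sub hφlog (hglog.const_mul c), integral_const_mul,
    integral_neg_log_abs_mul_gaussian, hsplit] at hmain
  nth_rw 1 [hA_eq] at hmain
  rw [hB_eq, integral_sub hφA (hgA.const_mul c), integral_sub hφB (hgB.const_mul c),
    integral_const_mul, integral_const_mul] at hmain
  have hfp : (∫ t in {t : ℝ | 0 < |t| ∧ |t| ≤ 1}, (g t - 1) / ((2 * |t| : ℝ) : ℂ))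
        + ∫ t in {t : ℝ | 1 < |t|}, g t / ((2 * |t| : ℝ) : ℂ)
      = ((-(Real.eulerMascheroniConstant + Real.log π) / 2 : ℝ) : ℂ) :=
    integral_gaussian_div_abs_finite_part
  have hlog4 : Real.log (4 * π) = 2 * Real.log (2 * π) - Real.log π := by
    rw [Real.log_mul two_ne_zero Real.pi_ne_zero, Real.log_mul four_ne_zero Real.pi_ne_zero,
      show (4 : ℝ) = 2 ^ 2 by norm_num, Real.log_pow]
    push_cast
    ring
  rw [hlog4] at hmain
  push_cast at hmain hfp ⊢
  linear_combination hmain - c * hfp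
end

section
/- (Mellin–Fourier relation) Let g : (0,∞) → ℂ be smooth and compactly supported, and set g_r(t) = g(|t|) for t ∈ ℝ (a Schwartz function on ℝ). Then for every c with 0 < c < 1 and every x ≠ 0, (𝓕⁻¹g_r)(x) = (1/2π)·∫_ℝ ĝ(c+iτ)·|x|^{c+iτ−1}·Γ_r(c+iτ)^{−1} dτ, where the integral converges absolutely. -/
open scoped Real FourierTransform

open Complex MeasureTheory Set

/-- The real Tate–Gel'fand–Graev gamma factor `Γ_r(s) = π^(1/2-s) Γ(s/2)/Γ((1-s)/2)`. -/
noncomputable def GammaR (s : ℂ) : ℂ :=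
  (π : ℂ) ^ (1 / 2 - s) * Complex.Gamma (s / 2) / Complex.Gamma ((1 - s) / 2)

open Filter Topology Asymptotics
open scoped SchwartzMap

namespace SchwartzMap

lemma isBigO_atTop_rpow (φ : 𝓢(ℝ, ℂ)) (a : ℝ) : φ =O[atTop] (· ^ (-a) : ℝ → ℝ) := by
  refine ((φ.isBigO_cocompact_rpow (-a)).mono atTop_le_cocompact).trans
    (EventuallyEq.isBigO ?_)
  filter_upwards [eventually_ge_atTop 0] with t ht
  rw [Real.norm_of_nonneg ht]

lemma isBigO_nhdsGT_zero (φ : 𝓢(ℝ, ℂ)) : φ =O[𝓝[>] 0] (· ^ (-0 : ℝ) : ℝ → ℝ) := by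
  simp only [neg_zero, Real.rpow_zero]
  exact (φ.continuous.continuousAt.tendsto.isBigO_one ℝ).mono nhdsWithin_le_nhds

lemma mellinConvergent (φ : 𝓢(ℝ, ℂ)) {s : ℂ} (hs : 0 < s.re) : MellinConvergent φ s :=
  mellinConvergent_of_isBigO_rpow (φ.continuous.locallyIntegrable.locallyIntegrableOn _)
    (φ.isBigO_atTop_rpow (s.re + 1)) (by linarith) φ.isBigO_nhdsGT_zero hs

lemma differentiableAt_mellin (φ : 𝓢(ℝ, ℂ)) {s : ℂ} (hs : 0 < s.re) :
    DifferentiableAt ℂ (mellin φ) s :=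
  mellin_differentiableAt_of_isBigO_rpow (φ.continuous.locallyIntegrable.locallyIntegrableOn _)
    (φ.isBigO_atTop_rpow (s.re + 1)) (by linarith) φ.isBigO_nhdsGT_zero hs

lemma mellin_derivCLM (φ : 𝓢(ℝ, ℂ)) {s : ℂ} (hs : 0 < s.re) :
    mellin (derivCLM ℂ ℂ φ) (s + 1) = -(s * mellin φ s) := by
  have hs0 : s ≠ 0 := by rintro rfl; simp at hs
  have h1 := (derivCLM ℂ ℂ φ).mellinConvergent (s := s + 1) (by simp; linarith)
  have h2 := φ.mellinConvergent hs
  have hb : ∀ t : ℝ, 0 < t → ‖(t : ℂ) ^ s * φ t‖ = t ^ s.re * ‖φ t‖ := fun t ht ↦ by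
    rw [norm_mul, norm_cpow_eq_rpow_re_of_pos ht]
  have key := integral_Ioi_mul_deriv_eq_deriv_mul (a := 0) (a' := 0) (b' := 0)
    (u := fun t : ℝ ↦ (t : ℂ) ^ s) (v := φ) (u' := fun t : ℝ ↦ s * (t : ℂ) ^ (s - 1))
    (v' := derivCLM ℂ ℂ φ)
    (fun t ht ↦ by
      simpa using (hasDerivAt_id (t : ℂ)).cpow_const (c := s) (.inl ht) |>.comp_ofReal)
    (fun t _ ↦ by simpa using φ.differentiableAt.hasDerivAt)
    (by simpa [MellinConvergent, Pi.mul_def] using h1)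
    (by simpa [MellinConvergent, IntegrableOn, mul_assoc, Pi.mul_def] using h2.const_mul s)
    (by
      rw [tendsto_zero_iff_norm_tendsto_zero]
      have : Tendsto (fun t : ℝ ↦ t ^ s.re * ‖φ t‖) (𝓝[>] 0) (𝓝 (0 ^ s.re * ‖φ 0‖)) :=
        (((Real.continuousAt_rpow_const 0 s.re (Or.inr hs.le)).mul
          φ.continuous.norm.continuousAt).tendsto).mono_left nhdsWithin_le_nhds
      rw [Real.zero_rpow hs.ne', zero_mul] at this
      refine this.congr' ?_
      filter_upwards [self_mem_nhdsWithin] with t ht using (hb t ht).symm)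
    (by
      have h3 : (fun t : ℝ ↦ (t : ℂ) ^ s * φ t) =O[atTop] fun t : ℝ ↦ t ^ (-1 : ℝ) := by
        have h4 : (fun t : ℝ ↦ (t : ℂ) ^ s) =O[atTop] fun t : ℝ ↦ t ^ s.re := by
          refine IsBigO.of_norm_eventuallyLE ?_
          filter_upwards [eventually_gt_atTop 0] with t ht
          rw [norm_cpow_eq_rpow_re_of_pos ht]
        refine (h4.mul (φ.isBigO_atTop_rpow (s.re + 1))).trans (EventuallyEq.isBigO ?_)
        filter_upwards [eventually_gt_atTop 0] with t ht
        rw [← Real.rpow_add ht]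
        ring_nf
      exact h3.trans_tendsto (tendsto_rpow_neg_atTop one_pos))
  simp only [mellin, add_sub_cancel_right, smul_eq_mul]
  rw [key, ← integral_const_mul]
  simp [mul_assoc]

lemma norm_mellin_le (φ : 𝓢(ℝ, ℂ)) (s : ℂ) :
    ‖mellin φ s‖ ≤ ∫ t in Ioi (0 : ℝ), t ^ (s.re - 1) * ‖φ t‖ := by
  refine (norm_integral_le_integral_norm _).trans_eq (setIntegral_congr_fun measurableSet_Ioi ?_)
  intro t ht
  simp [norm_cpow_eq_rpow_re_of_pos ht]

lemma verticalIntegrable_mellin (φ : 𝓢(ℝ, ℂ)) {c : ℝ} (hc : 0 < c) :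
    VerticalIntegrable (mellin φ) c := by
  set ψ := derivCLM ℂ ℂ (derivCLM ℂ ℂ φ) with hψ
  set C := ∫ t in Ioi (0 : ℝ), t ^ (c + 1 + 1 - 1) * ‖ψ t‖
  have hC : 0 ≤ C := setIntegral_nonneg measurableSet_Ioi fun t ht ↦
    mul_nonneg (Real.rpow_nonneg (le_of_lt ht) _) (norm_nonneg _)
  refine (integrable_inv_one_add_sq.const_mul (C * (1 + (c ^ 2)⁻¹))).mono' ?_ (.of_forall ?_)
  · refine Continuous.aestronglyMeasurable (continuous_iff_continuousAt.2 fun y ↦ ?_)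
    exact ContinuousAt.comp (f := fun y : ℝ ↦ (c : ℂ) + y * I)
      (φ.differentiableAt_mellin (by simpa)).continuousAt (by fun_prop)
  · intro y
    set s : ℂ := c + y * I with hs
    have hsre : s.re = c := by simp [hs]
    have hsim : s.im = y := by simp [hs]
    have h1 : mellin ψ (s + 1 + 1) = (s + 1) * s * mellin φ s := by
      rw [mellin_derivCLM _ (by simp [hsre]; linarith), mellin_derivCLM _ (by simpa [hsre])]
      ring
    have h2 : ‖s + 1‖ * ‖s‖ * ‖mellin φ s‖ ≤ C := by
      rw [← norm_mul, ← norm_mul, ← h1]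
      refine (norm_mellin_le _ _).trans_eq ?_
      simp [C, hsre]
    have h3 : ‖s‖ ^ 2 = c ^ 2 + y ^ 2 := by
      rw [← normSq_eq_norm_sq, normSq_apply, hsre, hsim]; ring
    have h4 : ‖s‖ ≤ ‖s + 1‖ := by
      refine (sq_le_sq₀ (norm_nonneg _) (norm_nonneg _)).1 ?_
      rw [h3, ← normSq_eq_norm_sq, normSq_apply]
      simp only [add_re, add_im, one_re, one_im, hsre, hsim]
      nlinarith
    have h5 : (c ^ 2 + y ^ 2) * ‖mellin φ s‖ ≤ C := by
      refine le_trans ?_ h2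
      rw [← h3, sq]
      gcongr
    have h6 : (1 + y ^ 2) ≤ (1 + (c ^ 2)⁻¹) * (c ^ 2 + y ^ 2) := by
      have : (c ^ 2)⁻¹ * c ^ 2 = 1 := inv_mul_cancel₀ (by positivity)
      have : 0 ≤ (c ^ 2)⁻¹ * y ^ 2 := by positivity
      nlinarith [sq_nonneg c]
    rw [← div_eq_mul_inv, le_div_iff₀ (by positivity)]
    calc ‖mellin φ s‖ * (1 + y ^ 2)
        ≤ ‖mellin φ s‖ * ((1 + (c ^ 2)⁻¹) * (c ^ 2 + y ^ 2)) := by gcongr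
      _ = (1 + (c ^ 2)⁻¹) * ((c ^ 2 + y ^ 2) * ‖mellin φ s‖) := by ring
      _ ≤ (1 + (c ^ 2)⁻¹) * C := by gcongr
      _ = _ := mul_comm _ _

lemma fourierInv_eq_fourier_of_even (f : 𝓢(ℝ, ℂ)) (hf : ∀ t, f (-t) = f t) (y : ℝ) :
    (𝓕⁻ f) y = (𝓕 f) y := by
  rw [fourierInv_coe, fourier_coe, Real.fourierInv_eq_fourier_comp_neg]
  simp only [hf]

lemma fourierInv_neg_of_even (f : 𝓢(ℝ, ℂ)) (hf : ∀ t, f (-t) = f t) (y : ℝ) :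
    (𝓕⁻ f) (-y) = (𝓕⁻ f) y := by
  rw [f.fourierInv_eq_fourier_of_even hf, fourierInv_coe, fourier_coe,
    Real.fourierInv_eq_fourier_neg]

end SchwartzMap

/-- The Mellin transform turns the multiplicative correlation of two functions into a product. -/
lemma mellin_integral_mul_comp_mul {f k : ℝ → ℂ} (hf : Measurable f) (hk : Measurable k) {w : ℂ}
    (hfw : MellinConvergent f (1 - w)) (hkw : MellinConvergent k w) :
    mellin (fun t ↦ ∫ a in Ioi (0 : ℝ), f a * k (a * t)) w = mellin f (1 - w) * mellin k w := by
  have hint : Integrable (Function.uncurry fun a t : ℝ ↦ (t : ℂ) ^ (w - 1) * (f a * k (a * t)))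
      ((volume.restrict (Ioi 0)).prod (volume.restrict (Ioi 0))) := by
    have hm : Measurable (Function.uncurry fun a t : ℝ ↦ (t : ℂ) ^ (w - 1) * (f a * k (a * t))) := by
      unfold Function.uncurry
      fun_prop
    rw [integrable_prod_iff hm.aestronglyMeasurable]
    constructor
    · filter_upwards [ae_restrict_mem measurableSet_Ioi] with a ha
      have := (((MellinConvergent.comp_mul_left ha).2 hkw).const_smul (f a))
      refine this.congr (.of_forall fun t ↦ ?_)
      simp
    · have h1 := (hfw.norm).mul_const (∫ t in Ioi (0 : ℝ), ‖(t : ℂ) ^ (w - 1) * k t‖)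
      refine h1.congr ?_
      filter_upwards [ae_restrict_mem measurableSet_Ioi] with a ha
      have ha' : (0 : ℝ) < a := ha
      have h2 := integral_comp_mul_left_Ioi (fun t : ℝ ↦ ‖(t : ℂ) ^ (w - 1) * k t‖) 0 ha'
      rw [mul_zero, smul_eq_mul] at h2
      have h3 : ∫ t in Ioi (0 : ℝ), ‖(t : ℂ) ^ (w - 1) * k t‖ =
          a * ∫ t in Ioi (0 : ℝ), ‖((a * t : ℝ) : ℂ) ^ (w - 1) * k (a * t)‖ := by
        rw [h2, mul_inv_cancel_left₀ ha'.ne']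
      rw [h3, ← integral_const_mul, ← integral_const_mul]
      refine setIntegral_congr_fun measurableSet_Ioi fun t ht ↦ ?_
      have ht' : (0 : ℝ) < t := ht
      have h4 : a ^ (-w.re) * a * a ^ (w.re - 1) = 1 := by
        rw [← Real.rpow_add_one ha'.ne', ← Real.rpow_add ha']
        simp
      simp only [Function.uncurry, norm_mul, norm_smul, norm_cpow_eq_rpow_re_of_pos ha',
        norm_cpow_eq_rpow_re_of_pos ht', norm_cpow_eq_rpow_re_of_pos (mul_pos ha' ht'),
        sub_re, one_re, Real.mul_rpow ha'.le ht'.le, sub_sub_cancel_left]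
      linear_combination (‖f a‖ * t ^ (w.re - 1) * ‖k (a * t)‖) * h4
  have hswap := integral_integral_swap hint
  calc mellin (fun t ↦ ∫ a in Ioi (0 : ℝ), f a * k (a * t)) w
      = ∫ t in Ioi (0 : ℝ), ∫ a in Ioi (0 : ℝ), (t : ℂ) ^ (w - 1) * (f a * k (a * t)) := by
        simp only [mellin, smul_eq_mul, integral_const_mul]
    _ = ∫ a in Ioi (0 : ℝ), f a * mellin (fun t ↦ k (a * t)) w := by
        rw [← hswap]
        simp only [mellin, smul_eq_mul, ← integral_const_mul]
        refine integral_congr_ae (.of_forall fun a ↦ integral_congr_ae (.of_forall fun t ↦ ?_))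
        ring
    _ = ∫ a in Ioi (0 : ℝ), (a : ℂ) ^ (1 - w - 1) * f a * mellin k w := by
        refine setIntegral_congr_fun measurableSet_Ioi fun a ha ↦ ?_
        rw [mellin_comp_mul_left _ _ ha, sub_sub_cancel_left, smul_eq_mul]
        ring
    _ = mellin f (1 - w) * mellin k w := by
        rw [integral_mul_const]
        simp only [mellin, smul_eq_mul]

lemma integral_eq_two_mul_integral_Ioi_of_even {f : ℝ → ℂ} (hf : Integrable f)
    (heven : ∀ t, f (-t) = f t) : ∫ t, f t = 2 * ∫ t in Ioi (0 : ℝ), f t := by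
  rw [← intervalIntegral.integral_Iic_add_Ioi hf.integrableOn hf.integrableOn (b := 0), two_mul]
  congr 1
  rw [← neg_zero, ← integral_comp_neg_Ioi, neg_zero]
  simp only [heven]

lemma mellinConvergent_gaussian {s : ℂ} (hs : 0 < s.re) :
    MellinConvergent (fun t : ℝ ↦ cexp (-π * t ^ 2)) s := by
  have h1 : MellinConvergent (fun t : ℝ ↦ ((Real.exp (-t) : ℝ) : ℂ)) (s / (2 : ℝ)) := by
    refine (GammaIntegral_convergent (s := s / (2 : ℝ)) (by simpa using hs)).congr
      (.of_forall fun t ↦ ?_)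
    simp [mul_comm]
  have h2 := (MellinConvergent.comp_rpow two_ne_zero).2
    ((MellinConvergent.comp_mul_left Real.pi_pos).2 h1)
  simpa using h2

lemma mellin_gaussian {s : ℂ} (hs : 0 < s.re) :
    mellin (fun t : ℝ ↦ cexp (-π * t ^ 2)) s = Gammaℝ s / 2 := by
  have h1 := mellin_comp_rpow (fun t : ℝ ↦ ((Real.exp (-(π * t)) : ℝ) : ℂ)) s 2
  rw [mellin_comp_mul_left (fun t : ℝ ↦ ((Real.exp (-t) : ℝ) : ℂ)) _ Real.pi_pos,
    ← GammaIntegral_eq_mellin, ← Gamma_eq_integral (by simpa using hs)] at h1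
  rw [Gammaℝ_def, neg_div, div_eq_inv_mul]
  simpa using h1

/-- Parseval's identity for an even Schwartz function against a dilated Gaussian. -/
lemma integral_Ioi_mul_gaussian {f : 𝓢(ℝ, ℂ)} (hf : ∀ t, f (-t) = f t) {t : ℝ} (ht : 0 < t) :
    ∫ a in Ioi (0 : ℝ), f a * cexp (-π * ((a * t : ℝ) : ℂ) ^ 2) =
      ∫ a in Ioi (0 : ℝ), cexp (-π * (a : ℂ) ^ 2) * (𝓕⁻ f) (a * t) := by
  have ht2 : 0 < ((t : ℂ) ^ 2)⁻¹.re := by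
    rw [← ofReal_pow, ← ofReal_inv, ofReal_re]; positivity
  have hsqrt : ((t : ℂ) ^ 2)⁻¹ ^ (1 / 2 : ℂ) = (t : ℂ)⁻¹ := by
    have h := congrArg ofReal (Real.sqrt_sq (inv_nonneg.2 ht.le))
    rw [Real.sqrt_eq_rpow, ofReal_cpow (by positivity)] at h
    simpa using h
  have hG : 𝓕 (fun y : ℝ ↦ cexp (-π * ((t : ℂ) ^ 2)⁻¹ * (y : ℂ) ^ 2)) =
      fun a : ℝ ↦ t * cexp (-π * ((a * t : ℝ) : ℂ) ^ 2) := by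
    rw [fourier_gaussian_pi ht2]
    ext a
    rw [hsqrt, one_div, inv_inv, div_inv_eq_mul]
    push_cast
    ring_nf
  have hk : Integrable fun y : ℝ ↦ cexp (-π * ((t : ℂ) ^ 2)⁻¹ * (y : ℂ) ^ 2) := by
    have := integrable_cexp_neg_mul_sq (b := π * ((t : ℂ) ^ 2)⁻¹)
      (by rw [re_ofReal_mul]; positivity)
    simpa only [neg_mul] using this
  have hk' : Integrable fun y : ℝ ↦ cexp (-π * (y : ℂ) ^ 2) := by
    simpa only [neg_mul] using integrable_cexp_neg_mul_sq (b := π) (by simpa using Real.pi_pos)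
  have hpars : ∫ y : ℝ, (𝓕 f) y * cexp (-π * ((t : ℂ) ^ 2)⁻¹ * (y : ℂ) ^ 2) =
      ∫ a : ℝ, f a * (t * cexp (-π * ((a * t : ℝ) : ℂ) ^ 2)) := by
    rw [SchwartzMap.fourier_coe]
    have := VectorFourier.integral_fourierIntegral_smul_eq_flip (L := innerₗ ℝ)
      Real.continuous_fourierChar continuous_inner (f.integrable (μ := volume)) hk
    simp only [smul_eq_mul, flip_innerₗ] at this
    exact this.trans (integral_congr_ae (.of_forall fun a ↦
      congrArg (f a * ·) (congrFun hG a)))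
  have hbdd : ∀ {y : ℝ}, ‖(𝓕⁻ f) y‖ ≤ SchwartzMap.seminorm ℝ 0 0 (𝓕⁻ f) := fun {y} ↦
    SchwartzMap.norm_le_seminorm ℝ _ y
  have hint1 : Integrable fun a : ℝ ↦ f a * cexp (-π * ((a * t : ℝ) : ℂ) ^ 2) := by
    refine f.integrable.mul_bdd (c := 1) (by fun_prop) (.of_forall fun a ↦ ?_)
    rw [norm_exp, Real.exp_le_one_iff, ← ofReal_pow, ← ofReal_neg, ← ofReal_mul, ofReal_re]
    nlinarith [Real.pi_pos, sq_nonneg (a * t), mul_nonneg Real.pi_pos.le (sq_nonneg (a * t))]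
  have hint2 : Integrable fun a : ℝ ↦ cexp (-π * (a : ℂ) ^ 2) * (𝓕⁻ f) (a * t) := by
    refine hk'.mul_bdd ?_ (.of_forall fun a ↦ hbdd)
    exact ((𝓕⁻ f).continuous.comp (by fun_prop)).aestronglyMeasurable
  refine mul_left_cancel₀ two_ne_zero ?_
  rw [← integral_eq_two_mul_integral_Ioi_of_even hint1 (by simp [hf]),
    ← integral_eq_two_mul_integral_Ioi_of_even hint2 (by simp [f.fourierInv_neg_of_even hf])]
  have htC : (t : ℂ) ≠ 0 := ofReal_ne_zero.2 ht.ne'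
  refine mul_left_cancel₀ htC ?_
  have hcomp := Measure.integral_comp_mul_right
    (fun y : ℝ ↦ (𝓕 f) y * cexp (-π * ((t : ℂ) ^ 2)⁻¹ * (y : ℂ) ^ 2)) t
  rw [abs_of_pos (inv_pos.2 ht), hpars, real_smul, ofReal_inv, eq_inv_mul_iff_mul_eq₀ htC] at hcomp
  rw [← integral_const_mul]
  simp only [mul_left_comm (t : ℂ)]
  rw [← hcomp]
  congr 1
  refine integral_congr_ae (.of_forall fun a ↦ ?_)
  simp only [f.fourierInv_eq_fourier_of_even hf]
  rw [mul_comm]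
  congr 2
  push_cast
  field_simp

/-- Tate's local functional equation for an even Schwartz function. -/
lemma mellin_fourierInv_mul_Gammaℝ {f : 𝓢(ℝ, ℂ)} (hf : ∀ t, f (-t) = f t) {w : ℂ}
    (hw0 : 0 < w.re) (hw1 : w.re < 1) :
    mellin ⇑(𝓕⁻ f : 𝓢(ℝ, ℂ)) w * Gammaℝ (1 - w) = mellin f (1 - w) * Gammaℝ w := by
  have h1w : 0 < (1 - w).re := by simpa using hw1
  have h1 := mellin_integral_mul_comp_mul f.continuous.measurable (by fun_prop)
    (f.mellinConvergent h1w) (mellinConvergent_gaussian hw0)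
  have h2 := mellin_integral_mul_comp_mul (by fun_prop) (𝓕⁻ f).continuous.measurable
    (mellinConvergent_gaussian h1w) ((𝓕⁻ f : 𝓢(ℝ, ℂ)).mellinConvergent hw0)
  have h3 : mellin f (1 - w) * (Gammaℝ w / 2) = Gammaℝ (1 - w) / 2 * mellin ⇑(𝓕⁻ f : 𝓢(ℝ, ℂ)) w := by
    rw [← mellin_gaussian hw0, ← mellin_gaussian h1w, ← h1, ← h2]
    refine setIntegral_congr_fun measurableSet_Ioi fun t ht ↦ ?_
    simp only [integral_Ioi_mul_gaussian hf ht]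
  linear_combination (-2) * h3

lemma GammaR_eq_div (s : ℂ) : GammaR s = Gammaℝ s / Gammaℝ (1 - s) := by
  have hpi : (π : ℂ) ≠ 0 := ofReal_ne_zero.2 Real.pi_ne_zero
  rw [GammaR, Gammaℝ_def, Gammaℝ_def, mul_div_mul_comm, ← cpow_sub _ _ hpi, mul_div_assoc]
  congr 2
  ring

/-- The even extension of a test function on the half-line is a Schwartz function. -/
lemma exists_schwartzMap_comp_abs {g : ℝ → ℂ} (hgsm : ContDiff ℝ (⊤ : ℕ∞) g)
    (hgs : HasCompactSupport g) (hgsupp : tsupport g ⊆ Ioi 0) :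
    ∃ f : 𝓢(ℝ, ℂ), ∀ t, f t = g |t| := by
  have hzero : ∀ t ≤ 0, g t = 0 := fun t ht ↦
    image_eq_zero_of_notMem_tsupport fun h ↦ (hgsupp h).not_ge ht
  have hneg : HasCompactSupport fun t ↦ g (-t) := hgs.comp_homeomorph (Homeomorph.neg ℝ)
  have hc : HasCompactSupport fun t ↦ g t + g (-t) := hgs.add hneg
  refine ⟨hc.toSchwartzMap (by fun_prop), fun t ↦ ?_⟩
  change g t + g (-t) = g |t|
  rcases le_total 0 t with ht | ht
  · rw [abs_of_nonneg ht, hzero (-t) (by linarith), add_zero]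
  · rw [abs_of_nonpos ht, hzero t ht, zero_add]

/-- **Mellin–Fourier relation.**  Let `g : (0,∞) → ℂ` be smooth and compactly supported and
set `g_r(t) = g(|t|)`.  Then for every `0 < c < 1` and every `x ≠ 0`,
`(𝓕⁻¹ g_r)(x) = (1/2π) ∫_ℝ ĝ(c+iτ)·|x|^(c+iτ-1)·Γ_r(c+iτ)⁻¹ dτ`,
the integral converging absolutely. -/
theorem mellin_fourier_relation (g : ℝ → ℂ)
    (hgsm : ContDiff ℝ (⊤ : ℕ∞) g) (hgs : HasCompactSupport g) (hgsupp : tsupport g ⊆ Ioi 0)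
    (c : ℝ) (hc0 : 0 < c) (hc1 : c < 1) (x : ℝ) (hx : x ≠ 0) :
    Integrable
      (fun τ : ℝ =>
        mellin g (c + τ * I) * ((|x| : ℝ) : ℂ) ^ ((c + τ * I) - 1) * (GammaR (c + τ * I))⁻¹) ∧
    𝓕⁻ (fun t : ℝ => g |t|) x
      = (1 / (2 * (π : ℂ))) *
          ∫ τ : ℝ,
            mellin g (c + τ * I) * ((|x| : ℝ) : ℂ) ^ ((c + τ * I) - 1) * (GammaR (c + τ * I))⁻¹ := by
  obtain ⟨f, hf⟩ := exists_schwartzMap_comp_abs hgsm hgs hgsupp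
  have hfeven : ∀ t, f (-t) = f t := fun t ↦ by rw [hf, hf, abs_neg]
  have hmellin : mellin f = mellin g := by
    ext s
    refine setIntegral_congr_fun measurableSet_Ioi fun t ht ↦ ?_
    simp only [hf, abs_of_pos (mem_Ioi.1 ht)]
  have hx0 : 0 < |x| := abs_pos.2 hx
  have hxC : ((|x| : ℝ) : ℂ) ≠ 0 := ofReal_ne_zero.2 hx0.ne'
  set H : ℝ → ℂ := fun y ↦ ((|x| : ℝ) : ℂ) ^ (-(((1 - c : ℝ) : ℂ) + y * I)) *
    mellin ⇑(𝓕⁻ f : 𝓢(ℝ, ℂ)) ((1 - c : ℝ) + y * I) with hH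
  have hHint : Integrable H := by
    refine ((𝓕⁻ f).verticalIntegrable_mellin (c := 1 - c) (by linarith)).bdd_mul
      (c := |x| ^ (-(1 - c))) ?_ (.of_forall fun y ↦ ?_)
    · refine Continuous.aestronglyMeasurable ?_
      exact (Continuous.const_cpow (by fun_prop) (.inl hxC))
    · rw [norm_cpow_eq_rpow_re_of_pos hx0]
      simp
  have hpt : ∀ τ : ℝ, mellin g (c + τ * I) * ((|x| : ℝ) : ℂ) ^ ((c + τ * I) - 1) *
      (GammaR (c + τ * I))⁻¹ = H (-τ) := fun τ ↦ by
    have hs : ((1 - c : ℝ) : ℂ) + ((-τ : ℝ) : ℂ) * I = 1 - (c + τ * I) := by push_cast; ring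
    have hfe := mellin_fourierInv_mul_Gammaℝ hfeven (w := 1 - (c + τ * I))
      (by simpa using hc1) (by simpa using hc0)
    have hne : Gammaℝ (c + τ * I) ≠ 0 := Gammaℝ_ne_zero_of_re_pos (by simpa using hc0)
    rw [sub_sub_cancel, hmellin, ← eq_div_iff hne] at hfe
    simp only [hH]
    rw [hs, hfe, GammaR_eq_div, inv_div, neg_sub]
    ring
  simp only [hpt]
  refine ⟨hHint.comp_neg, ?_⟩
  rw [integral_neg_eq_self H]
  have hinv := mellinInv_mellin_eq (1 - c) ⇑(𝓕⁻ f : 𝓢(ℝ, ℂ)) hx0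
    ((𝓕⁻ f : 𝓢(ℝ, ℂ)).mellinConvergent (by simpa using hc1))
    ((𝓕⁻ f).verticalIntegrable_mellin (by linarith)) (𝓕⁻ f).continuous.continuousAt
  have hFabs : 𝓕⁻ (fun t : ℝ ↦ g |t|) x = (𝓕⁻ f) |x| := by
    have h1 : (fun t : ℝ ↦ g |t|) = f := funext fun t ↦ (hf t).symm
    rw [h1, ← SchwartzMap.fourierInv_coe]
    rcases abs_choice x with h | h
    · rw [h]
    · rw [h, f.fourierInv_neg_of_even hfeven]
  rw [hFabs, ← hinv, mellinInv, real_smul]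
  simp [hH]
end

section
/- (The conductor operator commutes with inversion, real even case) Let φ : ℝ → ℂ be smooth, even, and compactly supported in ℝ∖{0}, and define (Iφ)(t) = (1/|t|)·φ(1/t) for t ≠ 0 and (Iφ)(0) = 0, which is again smooth, even, and compactly supported in ℝ∖{0}. With (Hψ)(t) = log|t|·ψ(t) + 𝓕( ξ ↦ log|ξ|·(𝓕⁻¹ψ)(ξ) )(t) for t ≠ 0, one has for every t ≠ 0: (H(Iφ))(t) = (1/|t|)·(Hφ)(1/t), i.e. H ∘ I = I ∘ H on such functions. -/
open scoped Real FourierTransform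

open Complex MeasureTheory Set

/-- The conductor operator at the real place:
`(Hψ)(t) = log|t|·ψ(t) + 𝓕( ξ ↦ log|ξ|·(𝓕⁻¹ψ)(ξ) )(t)`. -/
noncomputable def conductorOp (f : ℝ → ℂ) (t : ℝ) : ℂ :=
  ((Real.log |t| : ℝ) : ℂ) * f t
    + 𝓕 (fun ξ : ℝ => ((Real.log |ξ| : ℝ) : ℂ) * 𝓕⁻ f ξ) t

/-- The inversion `(Iφ)(t) = (1/|t|)·φ(1/t)` (with `(Iφ)(0) = 0`). -/
noncomputable def inversionOp (f : ℝ → ℂ) (t : ℝ) : ℂ := ((|t|⁻¹ : ℝ) : ℂ) * f t⁻¹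

/-- The Frullani integrand of the exponential is dominated by an exponential. -/
lemma abs_inv_mul_exp_sub_exp_le {a b x : ℝ} (hx : 0 < x) :
    |x⁻¹ * (Real.exp (-(a * x)) - Real.exp (-(b * x)))|
      ≤ |b - a| * Real.exp (-(min a b * x)) := by
  wlog hab : a ≤ b generalizing a b
  · have := this (a := b) (b := a) (le_of_not_ge hab)
    rwa [← abs_neg, ← mul_neg, neg_sub, abs_sub_comm, min_comm]
  rw [min_eq_left hab, abs_of_nonneg (sub_nonneg.2 hab), abs_mul, abs_of_pos (inv_pos.2 hx),
    inv_mul_le_iff₀ hx, abs_of_nonneg (sub_nonneg.2 (Real.exp_le_exp.2 (by nlinarith)))]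
  have h1 : Real.exp (-(b * x)) = Real.exp (-(a * x)) * Real.exp (-((b - a) * x)) := by
    rw [← Real.exp_add]; ring_nf
  have h2 := Real.add_one_le_exp (-((b - a) * x))
  rw [h1]
  nlinarith [Real.exp_pos (-(a * x))]

lemma integrableOn_inv_mul_exp_sub_exp {a b : ℝ} (ha : 0 < a) (hb : 0 < b) :
    IntegrableOn (fun x : ℝ => x⁻¹ * (Real.exp (-(a * x)) - Real.exp (-(b * x)))) (Ioi 0) := by
  refine Integrable.mono' (g := fun x => |b - a| * Real.exp (-(min a b * x))) ?_
    (by fun_prop) ?_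
  · simpa only [neg_mul] using! (exp_neg_integrableOn_Ioi 0 (lt_min ha hb)).const_mul |b - a|
  · filter_upwards [ae_restrict_mem measurableSet_Ioi] with x hx
    exact abs_inv_mul_exp_sub_exp_le hx

lemma integral_inv_mul_exp_sub_exp {a b : ℝ} (ha : 0 < a) (hb : 0 < b) :
    ∫ x in Ioi (0 : ℝ), x⁻¹ * (Real.exp (-(a * x)) - Real.exp (-(b * x))) = Real.log (b / a) := by
  have hc : Continuous (fun x : ℝ => Real.exp (-x)) := by fun_prop
  have := Frullani.integral_Ioi_eq (f := fun x : ℝ => Real.exp (-x)) (L := 1) (R := 0)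
    (hc.locallyIntegrable.locallyIntegrableOn _) ha hb
    ((hc.tendsto' 0 1 (by simp)).mono_left nhdsWithin_le_nhds)
    (Real.tendsto_exp_atBot.comp Filter.tendsto_neg_atTop_atBot)
    (by simpa using! integrableOn_inv_mul_exp_sub_exp ha hb)
  simpa using this

/-- The `L¹` form of Frullani's integral of the exponential. -/
lemma integral_abs_inv_mul_exp_sub_exp {a b : ℝ} (ha : 0 < a) (hb : 0 < b) :
    ∫ x in Ioi (0 : ℝ), |x⁻¹ * (Real.exp (-(a * x)) - Real.exp (-(b * x)))|
      = |Real.log (b / a)| := by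
  wlog hab : a ≤ b generalizing a b
  · have := this hb ha (le_of_not_ge hab)
    rw [← inv_div, Real.log_inv, abs_neg, ← this]
    refine integral_congr_ae (Filter.Eventually.of_forall fun x => ?_)
    simp only
    rw [← abs_neg, ← mul_neg, neg_sub]
  rw [abs_of_nonneg (Real.log_nonneg ((one_le_div ha).2 hab)),
    ← integral_inv_mul_exp_sub_exp ha hb]
  refine setIntegral_congr_fun measurableSet_Ioi fun x (hx : 0 < x) => abs_of_nonneg ?_
  exact mul_nonneg (inv_pos.2 hx).le
    (sub_nonneg.2 (Real.exp_le_exp.2 (by nlinarith)))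

lemma log_pi_mul_sq_div_pi (ξ : ℝ) : Real.log (π * ξ ^ 2 / π) = 2 * Real.log |ξ| := by
  rw [mul_div_cancel_left₀ _ Real.pi_ne_zero, Real.log_abs, Real.log_pow]; norm_num

/-- The heat kernel on the line, integrated against `dx / x` over all times. -/
lemma integrableOn_heatKernel_div {u : ℝ} (hu : u ≠ 0) :
    IntegrableOn (fun x : ℝ => x⁻¹ * (x ^ (-(1 / 2) : ℝ) * Real.exp (-(π / x * u ^ 2)))) (Ioi 0) ∧
    ∫ x in Ioi (0 : ℝ), x⁻¹ * (x ^ (-(1 / 2) : ℝ) * Real.exp (-(π / x * u ^ 2))) = |u|⁻¹ := by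
  have hr : 0 < π * u ^ 2 := by positivity
  have hcongr : EqOn (fun x : ℝ => x⁻¹ * (x ^ (-(1 / 2) : ℝ) * Real.exp (-(π / x * u ^ 2))))
      (fun x => (|(-1 : ℝ)| * x ^ (-1 - 1 : ℝ)) •
        (fun y : ℝ => y ^ (1 / 2 - 1 : ℝ) * Real.exp (-(π * u ^ 2 * y))) (x ^ (-1 : ℝ))) (Ioi 0) := by
    intro x (hx : 0 < x)
    have h1 : x⁻¹ * x ^ (-(1 / 2) : ℝ) = x ^ (-1 - 1 : ℝ) * (x ^ (-1 : ℝ)) ^ (1 / 2 - 1 : ℝ) := by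
      rw [← Real.rpow_mul hx.le, ← Real.rpow_neg_one, ← Real.rpow_add hx, ← Real.rpow_add hx]
      norm_num
    simp only [smul_eq_mul, abs_neg, abs_one, one_mul]
    rw [← mul_assoc, ← mul_assoc, h1, Real.rpow_neg_one x]
    congr 3
    ring
  constructor
  · rw [integrableOn_congr_fun hcongr measurableSet_Ioi,
      integrableOn_Ioi_comp_rpow_iff
        (fun y : ℝ => y ^ (1 / 2 - 1 : ℝ) * Real.exp (-(π * u ^ 2 * y))) (by norm_num : (-1 : ℝ) ≠ 0)]
    have := integrableOn_rpow_mul_exp_neg_mul_rpow (p := 1) (s := 1 / 2 - 1) (b := π * u ^ 2)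
      (by norm_num) one_pos hr
    simpa only [Real.rpow_one, neg_mul] using! this
  · rw [setIntegral_congr_fun measurableSet_Ioi hcongr,
      integral_comp_rpow_Ioi
        (fun y : ℝ => y ^ (1 / 2 - 1 : ℝ) * Real.exp (-(π * u ^ 2 * y))) (by norm_num : (-1 : ℝ) ≠ 0),
      Real.integral_rpow_mul_exp_neg_mul_Ioi (by norm_num) hr, Real.Gamma_one_half_eq,
      Real.sqrt_eq_rpow, ← Real.mul_rpow (by positivity) Real.pi_pos.le,
      ← Real.sqrt_eq_rpow, ← Real.sqrt_sq (by positivity : 0 ≤ |u|⁻¹)]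
    congr 1
    rw [inv_pow, sq_abs]
    field_simp

/-- The product of `log |·|` and a Schwartz function is integrable. -/
lemma SchwartzMap.integrable_log_abs_mul (f : SchwartzMap ℝ ℂ) :
    Integrable (fun ξ : ℝ => ((Real.log |ξ| : ℝ) : ℂ) * f ξ) := by
  obtain ⟨C, hC⟩ : ∃ C, ∀ x, ‖f x‖ ≤ C := by
    obtain ⟨C, -, hC⟩ := f.decay 0 0
    exact ⟨C, by simpa using hC⟩
  have hmeas : AEStronglyMeasurable (fun ξ : ℝ => ((Real.log |ξ| : ℝ) : ℂ) * f ξ) volume := by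
    have := f.continuous
    have h1 : Measurable (fun ξ : ℝ => ((Real.log |ξ| : ℝ) : ℂ)) := by fun_prop
    exact h1.aestronglyMeasurable.mul this.aestronglyMeasurable
  have hlog : IntegrableOn (fun ξ : ℝ => Real.log |ξ|) (Icc (-1) 1) := by
    rw [integrableOn_Icc_iff_integrableOn_Ioc]
    simpa only [Real.log_abs] using
      (intervalIntegrable_iff_integrableOn_Ioc_of_le (by norm_num : (-1 : ℝ) ≤ 1)).1
        (intervalIntegral.intervalIntegrable_log' (a := -1) (b := 1))
  have h1 := (integrable_indicator_iff measurableSet_Icc).2 (hlog.norm.const_mul C)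
  refine (h1.add (f.integrable_pow_mul volume 1)).mono' hmeas
    (Filter.Eventually.of_forall fun ξ => ?_)
  simp only [norm_mul, Complex.norm_real, Pi.add_apply, pow_one]
  by_cases hξ : ξ ∈ Icc (-1 : ℝ) 1
  · rw [indicator_of_mem hξ, mul_comm]
    have := mul_le_mul_of_nonneg_right (hC ξ) (norm_nonneg (Real.log |ξ|))
    have : 0 ≤ ‖ξ‖ * ‖f ξ‖ := by positivity
    linarith
  · rw [indicator_of_notMem hξ, zero_add]
    refine mul_le_mul_of_nonneg_right ?_ (norm_nonneg _)
    have h : 1 < |ξ| := by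
      by_contra! h
      exact hξ (abs_le.1 h)
    rw [Real.norm_of_nonneg (Real.log_nonneg h.le), Real.norm_eq_abs]
    exact (Real.log_le_sub_one_of_pos (by linarith)).trans (by linarith)

/-- Pairing the Fourier transform of a Schwartz function with a Gaussian. -/
lemma SchwartzMap.integral_gaussian_mul_fourier (h : SchwartzMap ℝ ℂ) {x : ℝ} (hx : 0 < x) :
    ∫ ξ : ℝ, ((Real.exp (-(π * ξ ^ 2 * x)) : ℝ) : ℂ) * 𝓕 (h : ℝ → ℂ) ξ
      = ∫ u : ℝ, ((x ^ (-(1 / 2) : ℝ) * Real.exp (-(π / x * u ^ 2)) : ℝ) : ℂ) * h u := by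
  have hxre : 0 < (x : ℂ).re := by simpa using hx
  have hG := fourier_gaussian_pi hxre
  have hGi : Integrable (fun ξ : ℝ => cexp (-π * x * ξ ^ 2)) := by
    simpa only [neg_mul] using! integrable_cexp_neg_mul_sq (b := π * x)
      (by rw [← Complex.ofReal_mul]; simpa using mul_pos Real.pi_pos hx)
  have key := VectorFourier.integral_fourierIntegral_smul_eq_flip (L := innerₗ ℝ)
    (μ := volume) (ν := volume) Real.continuous_fourierChar continuous_inner hGi
    (h.integrable (μ := volume))
  have key' : ∫ u : ℝ, 𝓕 (fun ξ : ℝ => cexp (-π * x * ξ ^ 2)) u * h u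
      = ∫ ξ : ℝ, cexp (-π * x * ξ ^ 2) * 𝓕 (h : ℝ → ℂ) ξ := by
    simpa only [flip_innerₗ] using! key
  rw [hG] at key'
  convert key'.symm using 3 with ξ u
  · push_cast
    congr 2
    ring
  · push_cast
    rw [Complex.ofReal_cpow hx.le, one_div ((x : ℂ) ^ (1 / 2 : ℂ)), ← Complex.cpow_neg]
    push_cast
    ring_nf

lemma SchwartzMap.integrable_exp_sub_exp_mul (F : SchwartzMap ℝ ℂ) :
    Integrable (Function.uncurry fun ξ x : ℝ =>
      ((x⁻¹ * (Real.exp (-(π * x)) - Real.exp (-(π * ξ ^ 2 * x))) : ℝ) : ℂ) * F ξ)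
      (volume.prod (volume.restrict (Ioi 0))) := by
  have hF := F.continuous
  have h0 : ∀ᵐ ξ : ℝ, ξ ≠ 0 := compl_mem_ae_iff.2 (measure_singleton 0)
  rw [integrable_prod_iff (by unfold Function.uncurry; fun_prop)]
  constructor
  · filter_upwards [h0] with ξ hξ
    exact (Integrable.ofReal (𝕜 := ℂ) (integrableOn_inv_mul_exp_sub_exp Real.pi_pos
      (by positivity : 0 < π * ξ ^ 2))).mul_const (F ξ)
  · refine (F.integrable_log_abs_mul.norm.const_mul 2).congr ?_
    filter_upwards [h0] with ξ hξ
    simp only [Function.uncurry, norm_mul, Complex.norm_real, Real.norm_eq_abs]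
    have := integral_abs_inv_mul_exp_sub_exp Real.pi_pos (by positivity : 0 < π * ξ ^ 2)
    simp only [abs_mul] at this
    rw [integral_mul_const, this, log_pi_mul_sq_div_pi, abs_mul, abs_two, mul_assoc]

lemma integrable_heatKernel_mul {h : ℝ → ℂ} (hc : Continuous h)
    (hint : Integrable fun u : ℝ => ((|u|⁻¹ : ℝ) : ℂ) * h u) :
    Integrable (Function.uncurry fun u x : ℝ =>
      ((x⁻¹ * (x ^ (-(1 / 2) : ℝ) * Real.exp (-(π / x * u ^ 2))) : ℝ) : ℂ) * h u)
      (volume.prod (volume.restrict (Ioi 0))) := by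
  have h0 : ∀ᵐ u : ℝ, u ≠ 0 := compl_mem_ae_iff.2 (measure_singleton 0)
  rw [integrable_prod_iff (by unfold Function.uncurry; fun_prop)]
  constructor
  · filter_upwards [h0] with u hu
    exact (Integrable.ofReal (𝕜 := ℂ) (integrableOn_heatKernel_div hu).1).mul_const (h u)
  · refine hint.norm.congr ?_
    filter_upwards [h0] with u hu
    simp only [Function.uncurry]
    rw [norm_mul, Complex.norm_real, Real.norm_of_nonneg (by positivity),
      ← (integrableOn_heatKernel_div hu).2, ← integral_mul_const]
    refine setIntegral_congr_fun measurableSet_Ioi fun x (hx : 0 < x) => ?_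
    rw [norm_mul, Complex.norm_real, Real.norm_of_nonneg (by positivity)]

/-- The Fourier transform of `log |·|` is `-1 / (2 |·|)` on Schwartz functions vanishing at `0`. -/
lemma SchwartzMap.two_mul_integral_log_abs_mul_fourier (h : SchwartzMap ℝ ℂ) (h0 : h 0 = 0)
    (hint : Integrable fun u : ℝ => ((|u|⁻¹ : ℝ) : ℂ) * h u) :
    2 * ∫ ξ : ℝ, ((Real.log |ξ| : ℝ) : ℂ) * 𝓕 (h : ℝ → ℂ) ξ
      = -∫ u : ℝ, ((|u|⁻¹ : ℝ) : ℂ) * h u := by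
  have hne : ∀ᵐ ξ : ℝ, ξ ≠ 0 := compl_mem_ae_iff.2 (measure_singleton 0)
  have hFint : Integrable (𝓕 (h : ℝ → ℂ)) := (𝓕 h).integrable
  have hzero : ∫ ξ : ℝ, 𝓕 (h : ℝ → ℂ) ξ = 0 := by
    have := congrFun (h.continuous.fourierInv_fourier_eq h.integrable hFint) 0
    rw [Real.fourierInv_eq'] at this
    simpa [h0] using this
  have hslice {x : ℝ} (hx : 0 < x) :
      ∫ ξ : ℝ, ((x⁻¹ * (Real.exp (-(π * x)) - Real.exp (-(π * ξ ^ 2 * x))) : ℝ) : ℂ)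
          * 𝓕 (h : ℝ → ℂ) ξ
        = -∫ u : ℝ, ((x⁻¹ * (x ^ (-(1 / 2) : ℝ) * Real.exp (-(π / x * u ^ 2))) : ℝ) : ℂ)
          * h u := by
    have hGF : Integrable fun ξ : ℝ =>
        ((Real.exp (-(π * ξ ^ 2 * x)) : ℝ) : ℂ) * 𝓕 (h : ℝ → ℂ) ξ := by
      refine hFint.bdd_mul (c := 1) (by fun_prop) (Filter.Eventually.of_forall fun ξ => ?_)
      rw [Complex.norm_real, Real.norm_of_nonneg (Real.exp_pos _).le, Real.exp_le_one_iff]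
      exact neg_nonpos.2 (by positivity)
    have e1 : ∀ ξ : ℝ,
        ((x⁻¹ * (Real.exp (-(π * x)) - Real.exp (-(π * ξ ^ 2 * x))) : ℝ) : ℂ)
          * 𝓕 (h : ℝ → ℂ) ξ
        = (x⁻¹ : ℂ) * (((Real.exp (-(π * x)) : ℝ) : ℂ) * 𝓕 (h : ℝ → ℂ) ξ
          - ((Real.exp (-(π * ξ ^ 2 * x)) : ℝ) : ℂ) * 𝓕 (h : ℝ → ℂ) ξ) := fun ξ => by
      push_cast; ring
    have e2 : ∀ u : ℝ,
        ((x⁻¹ * (x ^ (-(1 / 2) : ℝ) * Real.exp (-(π / x * u ^ 2))) : ℝ) : ℂ) * h u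
        = (x⁻¹ : ℂ)
          * (((x ^ (-(1 / 2) : ℝ) * Real.exp (-(π / x * u ^ 2)) : ℝ) : ℂ) * h u) := fun u => by
      push_cast; ring
    simp_rw [e1, e2]
    rw [integral_const_mul, integral_const_mul, integral_sub (hFint.const_mul _) hGF,
      integral_const_mul, hzero, h.integral_gaussian_mul_fourier hx]
    ring
  calc 2 * ∫ ξ : ℝ, ((Real.log |ξ| : ℝ) : ℂ) * 𝓕 (h : ℝ → ℂ) ξ
      = ∫ ξ : ℝ, ∫ x in Ioi (0 : ℝ),
          ((x⁻¹ * (Real.exp (-(π * x)) - Real.exp (-(π * ξ ^ 2 * x))) : ℝ) : ℂ)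
            * 𝓕 (h : ℝ → ℂ) ξ := by
        rw [← integral_const_mul]
        refine integral_congr_ae ?_
        filter_upwards [hne] with ξ hξ
        rw [integral_mul_const, integral_complex_ofReal, integral_inv_mul_exp_sub_exp Real.pi_pos
          (by positivity : 0 < π * ξ ^ 2), log_pi_mul_sq_div_pi]
        push_cast
        ring
    _ = ∫ x in Ioi (0 : ℝ), ∫ ξ : ℝ,
          ((x⁻¹ * (Real.exp (-(π * x)) - Real.exp (-(π * ξ ^ 2 * x))) : ℝ) : ℂ)
            * 𝓕 (h : ℝ → ℂ) ξ :=
        integral_integral_swap (𝓕 h).integrable_exp_sub_exp_mul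
    _ = -∫ x in Ioi (0 : ℝ), ∫ u : ℝ,
          ((x⁻¹ * (x ^ (-(1 / 2) : ℝ) * Real.exp (-(π / x * u ^ 2))) : ℝ) : ℂ) * h u := by
        rw [← integral_neg]
        exact setIntegral_congr_fun measurableSet_Ioi fun x hx => hslice hx
    _ = -∫ u : ℝ, ∫ x in Ioi (0 : ℝ),
          ((x⁻¹ * (x ^ (-(1 / 2) : ℝ) * Real.exp (-(π / x * u ^ 2))) : ℝ) : ℂ) * h u := by
        rw [integral_integral_swap (integrable_heatKernel_mul h.continuous hint)]
    _ = -∫ u : ℝ, ((|u|⁻¹ : ℝ) : ℂ) * h u := by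
        congr 1
        refine integral_congr_ae ?_
        filter_upwards [hne] with u hu
        rw [integral_mul_const, integral_complex_ofReal, (integrableOn_heatKernel_div hu).2]

section Inversion

variable {f : ℝ → ℂ}

lemma inversionOp_eventuallyEq_zero (hcs : HasCompactSupport f) :
    inversionOp f =ᶠ[nhds 0] 0 := by
  obtain ⟨R, hR⟩ := hcs.isCompact.isBounded.subset_closedBall (0 : ℝ)
  have hpos : 0 < (|R| + 1)⁻¹ := by positivity
  filter_upwards [Metric.ball_mem_nhds (0 : ℝ) hpos] with t ht
  rcases eq_or_ne t 0 with rfl | h0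
  · simp [inversionOp]
  have hf : f t⁻¹ = 0 := by
    refine image_eq_zero_of_notMem_tsupport fun hmem => ?_
    have h1 := hR hmem
    rw [mem_closedBall_zero_iff, norm_inv] at h1
    rw [mem_ball_zero_iff, lt_inv_comm₀ (norm_pos_iff.2 h0) (by positivity)] at ht
    linarith [le_abs_self R]
  simp [inversionOp, hf]

lemma contDiff_inversionOp (hsm : ContDiff ℝ (⊤ : ℕ∞) f) (hcs : HasCompactSupport f) :
    ContDiff ℝ (⊤ : ℕ∞) (inversionOp f) := by
  refine contDiff_iff_contDiffAt.2 fun t => ?_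
  rcases eq_or_ne t 0 with rfl | h0
  · exact contDiffAt_const.congr_of_eventuallyEq (inversionOp_eventuallyEq_zero hcs)
  · have h1 : ContDiffAt ℝ (⊤ : ℕ∞) (fun s : ℝ => |s|⁻¹) t :=
      (contDiffAt_abs h0).inv (abs_ne_zero.2 h0)
    exact (Complex.ofRealCLM.contDiff.contDiffAt.comp t h1).mul
      (hsm.contDiffAt.comp t (contDiffAt_inv ℝ h0))

lemma hasCompactSupport_inversionOp (h0 : f =ᶠ[nhds 0] 0) :
    HasCompactSupport (inversionOp f) := by
  obtain ⟨δ, hδ, hball⟩ := Metric.eventually_nhds_iff_ball.1 h0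
  refine HasCompactSupport.intro (isCompact_closedBall (0 : ℝ) δ⁻¹) fun t ht => ?_
  rw [mem_closedBall_zero_iff, not_le] at ht
  have : f t⁻¹ = 0 := hball _ (by
    rw [mem_ball_zero_iff, norm_inv]
    exact inv_lt_of_inv_lt₀ hδ ht)
  simp [inversionOp, this]

lemma inversionOp_inversionOp {t : ℝ} (ht : t ≠ 0) : inversionOp (inversionOp f) t = f t := by
  have : ((|t| : ℝ) : ℂ) ≠ 0 := by exact_mod_cast abs_ne_zero.2 ht
  simp only [inversionOp, inv_inv, abs_inv, ← mul_assoc]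
  push_cast
  rw [inv_mul_cancel₀ this, one_mul]

/-- The inversion preserves the integral against the kernel `1 / |1 - u|`. -/
lemma integral_inv_abs_one_sub_mul_inversionOp (g : ℝ → ℂ) :
    ∫ u : ℝ, ((|1 - u|⁻¹ : ℝ) : ℂ) * inversionOp g u
      = ∫ u : ℝ, ((|1 - u|⁻¹ : ℝ) : ℂ) * g u := by
  have hs : MeasurableSet ({0}ᶜ : Set ℝ) := (measurableSet_singleton 0).compl
  have himage : (fun u : ℝ => u⁻¹) '' ({0}ᶜ : Set ℝ) = {0}ᶜ := by
    ext u
    simp only [mem_image, mem_compl_iff, mem_singleton_iff]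
    exact ⟨by rintro ⟨v, hv, rfl⟩; exact inv_ne_zero hv,
      fun hu => ⟨u⁻¹, inv_ne_zero hu, inv_inv u⟩⟩
  have hae : (volume.restrict ({0}ᶜ : Set ℝ)) = volume :=
    Measure.restrict_eq_self_of_ae_mem (compl_mem_ae_iff.2 (measure_singleton 0))
  have key := integral_image_eq_integral_abs_deriv_smul hs
    (fun u hu => (hasDerivAt_inv (mem_compl_singleton_iff.1 hu)).hasDerivWithinAt)
    (inv_injective.injOn) (fun u : ℝ => ((|1 - u|⁻¹ : ℝ) : ℂ) * g u)
  rw [himage] at key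
  rw [← hae, key]
  refine setIntegral_congr_fun hs fun u hu => ?_
  have hu : u ≠ 0 := hu
  have h1 : |1 - u⁻¹| = |1 - u| * |u|⁻¹ := by
    rw [← abs_inv, ← abs_mul, sub_mul, mul_inv_cancel₀ hu, one_mul, abs_sub_comm]
  have h2 : |-(u ^ 2)⁻¹| = |u|⁻¹ * |u|⁻¹ := by
    rw [abs_neg, abs_inv, abs_pow, sq, mul_inv]
  have h3 : |u|⁻¹ * |u| = 1 := inv_mul_cancel₀ (abs_ne_zero.2 hu)
  simp only [inversionOp, Complex.real_smul]
  rw [h1, h2, mul_inv, inv_inv, ← mul_assoc, ← mul_assoc, ← Complex.ofReal_mul,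
    ← Complex.ofReal_mul]
  congr 2
  linear_combination (-|1 - u|⁻¹ * |u|⁻¹) * h3

end Inversion

/-- A compactly supported Lipschitz function vanishing at the origin is integrable against
`1 / |·|`. -/
lemma HasCompactSupport.integrable_inv_abs_mul {h : ℝ → ℂ} (hcs : HasCompactSupport h)
    (hsm : ContDiff ℝ 1 h) (h0 : h 0 = 0) :
    Integrable fun u : ℝ => ((|u|⁻¹ : ℝ) : ℂ) * h u := by
  obtain ⟨C, hC⟩ := hsm.lipschitzWith_of_hasCompactSupport hcs one_ne_zero
  have hcont := hsm.continuous
  have hsupp : Function.support (fun u : ℝ => ((|u|⁻¹ : ℝ) : ℂ) * h u) ⊆ tsupport h :=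
    (Function.support_mul_subset_right _ _).trans (subset_tsupport h)
  rw [← integrableOn_iff_integrable_of_support_subset hsupp]
  refine Measure.integrableOn_of_bounded (M := C) hcs.isCompact.measure_lt_top.ne (by fun_prop)
    (Filter.Eventually.of_forall fun u => ?_)
  have h1 : ‖h u‖ ≤ C * |u| := by simpa [dist_eq_norm, h0] using hC.dist_le_mul u 0
  rw [norm_mul, Complex.norm_real, norm_inv, Real.norm_eq_abs, abs_abs]
  rcases eq_or_ne u 0 with rfl | hu
  · simp
  · rw [inv_mul_le_iff₀ (abs_pos.2 hu)]
    linarith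

section Conductor

lemma fourier_comp_one_sub (f : ℝ → ℂ) (ξ : ℝ) :
    𝓕 (fun s => f (1 - s)) ξ = cexp (((-2 * π * ξ : ℝ) : ℂ) * Complex.I) * 𝓕⁻ f ξ := by
  rw [Real.fourier_eq', Real.fourierInv_eq', ← integral_const_mul,
    ← integral_sub_left_eq_self _ volume (1 : ℝ)]
  refine integral_congr_ae (Filter.Eventually.of_forall fun v => ?_)
  simp only [smul_eq_mul, sub_sub_cancel, ← mul_assoc, ← Complex.exp_add]
  congr 2
  simp
  ring

lemma conductorOp_one (f : ℝ → ℂ) :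
    conductorOp f 1
      = ∫ ξ : ℝ, ((Real.log |ξ| : ℝ) : ℂ) * 𝓕 (fun s => f (1 - s)) ξ := by
  rw [conductorOp, Real.fourier_eq']
  simp only [abs_one, Real.log_one, Complex.ofReal_zero, zero_mul, zero_add]
  refine integral_congr_ae (Filter.Eventually.of_forall fun ξ => ?_)
  simp only [fourier_comp_one_sub, smul_eq_mul]
  simp
  ring

lemma conductorOp_const_mul_one (c : ℂ) (f : ℝ → ℂ) :
    conductorOp (fun u => c * f u) 1 = c * conductorOp f 1 := by
  have h (ξ : ℝ) : 𝓕 (fun s => c * f (1 - s)) ξ = c * 𝓕 (fun s => f (1 - s)) ξ := by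
    simp only [Real.fourier_eq', smul_eq_mul, ← integral_const_mul]
    refine integral_congr_ae (Filter.Eventually.of_forall fun v => ?_)
    simp only
    ring
  rw [conductorOp_one, conductorOp_one, ← integral_const_mul]
  refine integral_congr_ae (Filter.Eventually.of_forall fun ξ => ?_)
  simp only [h]
  ring

lemma fourierInv_comp_mul_left (f : ℝ → ℂ) {t : ℝ} (ht : t ≠ 0) (ξ : ℝ) :
    𝓕⁻ (fun u => f (t * u)) ξ = ((|t|⁻¹ : ℝ) : ℂ) * 𝓕⁻ f (t⁻¹ * ξ) := by
  rw [Real.fourierInv_eq', Real.fourierInv_eq', ← abs_inv, ← Complex.real_smul,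
    ← Measure.integral_comp_mul_left]
  refine integral_congr_ae (Filter.Eventually.of_forall fun v => ?_)
  have : inner ℝ (t * v) (t⁻¹ * ξ) = inner ℝ v ξ := by
    simp only [Real.inner_apply]
    field_simp
  simp only [this]

/-- The conductor operator commutes with dilations. -/
lemma SchwartzMap.conductorOp_comp_mul_left (f : SchwartzMap ℝ ℂ) {t : ℝ} (ht : t ≠ 0) :
    conductorOp (fun u => f (t * u)) 1 = conductorOp f t := by
  have hne : ∀ᵐ ξ : ℝ, ξ ≠ 0 := compl_mem_ae_iff.2 (measure_singleton 0)
  have hinv : ((𝓕⁻ f : SchwartzMap ℝ ℂ) : ℝ → ℂ) = 𝓕⁻ (f : ℝ → ℂ) := f.fourierInv_coe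
  have hFint : Integrable (𝓕⁻ (f : ℝ → ℂ)) := hinv ▸ (𝓕⁻ f : SchwartzMap ℝ ℂ).integrable
  have hlog : Integrable (fun ξ : ℝ => ((Real.log |ξ| : ℝ) : ℂ) * 𝓕⁻ (f : ℝ → ℂ) ξ) :=
    hinv ▸ (𝓕⁻ f : SchwartzMap ℝ ℂ).integrable_log_abs_mul
  have hFI : 𝓕 (𝓕⁻ (f : ℝ → ℂ)) t = f t := by
    rw [← hinv, ← SchwartzMap.fourier_coe, FourierTransform.fourier_fourierInv_eq]
  have hchar (w : ℝ) {g : ℝ → ℂ} (hg : Integrable g) :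
      Integrable fun v : ℝ => cexp (((-2 * π * inner ℝ v w : ℝ) : ℂ) * Complex.I) • g v := by
    refine hg.bdd_mul (c := 1) (by fun_prop) (Filter.Eventually.of_forall fun v => ?_)
    rw [Complex.norm_exp_ofReal_mul_I]
  calc conductorOp (fun u => f (t * u)) 1
      = ∫ ξ : ℝ, ((|t|⁻¹ : ℝ) : ℂ) * (cexp (((-2 * π * inner ℝ (t⁻¹ * ξ) t : ℝ) : ℂ) * Complex.I)
          * (((Real.log |t * (t⁻¹ * ξ)| : ℝ) : ℂ) * 𝓕⁻ (f : ℝ → ℂ) (t⁻¹ * ξ))) := by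
        rw [conductorOp, Real.fourier_eq']
        simp only [abs_one, Real.log_one, Complex.ofReal_zero, zero_mul, zero_add]
        refine integral_congr_ae (Filter.Eventually.of_forall fun ξ => ?_)
        have h1 : inner ℝ (t⁻¹ * ξ) t = inner ℝ ξ 1 := by
          simp only [Real.inner_apply]
          field_simp
        simp only [fourierInv_comp_mul_left f ht, smul_eq_mul, mul_inv_cancel_left₀ ht, h1]
        ring
    _ = ∫ η : ℝ, cexp (((-2 * π * inner ℝ η t : ℝ) : ℂ) * Complex.I)
          * (((Real.log |t * η| : ℝ) : ℂ) * 𝓕⁻ (f : ℝ → ℂ) η) := by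
        rw [integral_const_mul, Measure.integral_comp_inv_mul_left (fun η : ℝ =>
          cexp (((-2 * π * inner ℝ η t : ℝ) : ℂ) * Complex.I)
            * (((Real.log |t * η| : ℝ) : ℂ) * 𝓕⁻ (f : ℝ → ℂ) η)), Complex.real_smul, ← mul_assoc,
          ← Complex.ofReal_mul, inv_mul_cancel₀ (abs_ne_zero.2 ht), Complex.ofReal_one, one_mul]
    _ = conductorOp f t := by
        rw [conductorOp]
        rw [← hFI, Real.fourier_eq', Real.fourier_eq', ← integral_const_mul,
          ← integral_add ((hchar t hFint).const_mul _) (hchar t hlog)]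
        refine integral_congr_ae ?_
        filter_upwards [hne] with η hη
        rw [abs_mul, Real.log_mul (abs_ne_zero.2 ht) (abs_ne_zero.2 hη)]
        simp only [smul_eq_mul]
        push_cast
        ring

/-- The conductor operator commutes with inversion at the point `1`. -/
lemma conductorOp_inversionOp_one {f : ℝ → ℂ} (hsm : ContDiff ℝ (⊤ : ℕ∞) f)
    (hcs : HasCompactSupport f) (h0 : f =ᶠ[nhds 0] 0) :
    conductorOp (inversionOp f) 1 = conductorOp f 1 := by
  have hrefl {g : ℝ → ℂ} (hg : ContDiff ℝ (⊤ : ℕ∞) g) (hgc : HasCompactSupport g) :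
      ∃ G : SchwartzMap ℝ ℂ, (G : ℝ → ℂ) = (fun s => g (1 - s)) ∧ HasCompactSupport G := by
    have hc : HasCompactSupport fun s : ℝ => g (1 - s) :=
      hgc.comp_homeomorph (Homeomorph.subLeft (1 : ℝ))
    exact ⟨hc.toSchwartzMap (hg.comp (contDiff_const.sub contDiff_id)), rfl, hc⟩
  obtain ⟨G, hG, hGc⟩ :=
    hrefl (contDiff_inversionOp hsm hcs) (hasCompactSupport_inversionOp h0)
  obtain ⟨F, hF, hFc⟩ := hrefl hsm hcs
  have hFT : 𝓕 ((G - F : SchwartzMap ℝ ℂ) : ℝ → ℂ) =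
      fun ξ => 𝓕 (G : ℝ → ℂ) ξ - 𝓕 (F : ℝ → ℂ) ξ := by
    rw [← SchwartzMap.fourier_coe, sub_eq_add_neg, FourierTransform.fourier_add,
      FourierTransform.fourier_neg, ← sub_eq_add_neg]
    rfl
  have hzero : (G - F) 0 = 0 := by
    simp [hG, hF, inversionOp]
  have hc : HasCompactSupport (G - F : SchwartzMap ℝ ℂ) := hGc.sub hFc
  have hsmooth : ContDiff ℝ 1 (G - F : SchwartzMap ℝ ℂ) := (G - F).smooth 1
  have key := (G - F).two_mul_integral_log_abs_mul_fourier hzero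
    (hc.integrable_inv_abs_mul hsmooth hzero)
  have hlhs : ∫ ξ : ℝ, ((Real.log |ξ| : ℝ) : ℂ) * 𝓕 ((G - F : SchwartzMap ℝ ℂ) : ℝ → ℂ) ξ
      = conductorOp (inversionOp f) 1 - conductorOp f 1 := by
    rw [conductorOp_one, conductorOp_one, ← hG, ← hF, ← integral_sub
      (𝓕 G).integrable_log_abs_mul (𝓕 F).integrable_log_abs_mul, hFT]
    simp only [mul_sub]
  set g : ℝ → ℂ := fun u => inversionOp f u - f u with hg
  have hrhs : ∫ u : ℝ, ((|u|⁻¹ : ℝ) : ℂ) * (G - F) u = ∫ u : ℝ, ((|1 - u|⁻¹ : ℝ) : ℂ) * g u := by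
    rw [← integral_sub_left_eq_self _ volume (1 : ℝ)]
    simp [hG, hF, hg]
  have hanti : ∫ u : ℝ, ((|1 - u|⁻¹ : ℝ) : ℂ) * inversionOp g u
      = -∫ u : ℝ, ((|1 - u|⁻¹ : ℝ) : ℂ) * g u := by
    have hne : ∀ᵐ u : ℝ, u ≠ 0 := compl_mem_ae_iff.2 (measure_singleton 0)
    rw [← integral_neg]
    refine integral_congr_ae ?_
    filter_upwards [hne] with u hu
    have h1 : inversionOp g u = inversionOp (inversionOp f) u - inversionOp f u := by
      simp only [inversionOp, hg, mul_sub]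
    rw [h1, inversionOp_inversionOp hu]
    simp only [hg]
    ring
  rw [integral_inv_abs_one_sub_mul_inversionOp] at hanti
  rw [hlhs, hrhs, self_eq_neg.1 hanti, neg_zero] at key
  exact sub_eq_zero.1 ((mul_eq_zero.1 key).resolve_left two_ne_zero)

end Conductor

/-- **The conductor operator commutes with inversion (real, even case).**  For `φ` smooth,
even, compactly supported in `ℝ∖{0}`, the inversion `Iφ` is again smooth, even and
compactly supported in `ℝ∖{0}`, and for every `t ≠ 0`,
`(H(Iφ))(t) = (1/|t|)·(Hφ)(1/t)`. -/
theorem conductorOp_commutes_with_inversion (φ : ℝ → ℂ)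
    (hsm : ContDiff ℝ (⊤ : ℕ∞) φ) (heven : ∀ t : ℝ, φ (-t) = φ t)
    (hcs : HasCompactSupport φ) (hsupp : (0 : ℝ) ∉ tsupport φ) :
    (ContDiff ℝ (⊤ : ℕ∞) (inversionOp φ) ∧ (∀ t : ℝ, inversionOp φ (-t) = inversionOp φ t) ∧
      HasCompactSupport (inversionOp φ) ∧ (0 : ℝ) ∉ tsupport (inversionOp φ)) ∧
    ∀ t : ℝ, t ≠ 0 →
      conductorOp (inversionOp φ) t = ((|t|⁻¹ : ℝ) : ℂ) * conductorOp φ t⁻¹ := by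
  have h0 : φ =ᶠ[nhds 0] 0 := notMem_tsupport_iff_eventuallyEq.1 hsupp
  have hIsm := contDiff_inversionOp hsm hcs
  have hIcs := hasCompactSupport_inversionOp h0
  refine ⟨⟨hIsm, fun t => ?_, hIcs,
    notMem_tsupport_iff_eventuallyEq.2 (inversionOp_eventuallyEq_zero hcs)⟩, fun t ht => ?_⟩
  · simp only [inversionOp, abs_neg, inv_neg, heven]
  have ht' : t⁻¹ ≠ 0 := inv_ne_zero ht
  set f : ℝ → ℂ := fun u => φ (t⁻¹ * u) with hf
  have hfsm : ContDiff ℝ (⊤ : ℕ∞) f := hsm.comp (contDiff_const.mul contDiff_id)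
  have hfcs : HasCompactSupport f := hcs.comp_homeomorph (Homeomorph.mulLeft₀ t⁻¹ ht')
  have hf0 : f =ᶠ[nhds 0] 0 := by
    have : Filter.Tendsto (fun u : ℝ => t⁻¹ * u) (nhds 0) (nhds 0) :=
      (continuous_const.mul continuous_id).tendsto' 0 0 (mul_zero _)
    exact this.eventually h0
  have hscale : (fun u => inversionOp φ (t * u)) =
      fun u => ((|t|⁻¹ : ℝ) : ℂ) * inversionOp f u := by
    ext u
    simp only [inversionOp, hf, abs_mul, mul_inv]
    push_cast
    ring
  have h1 := (hIcs.toSchwartzMap hIsm).conductorOp_comp_mul_left ht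
  have h2 := (hcs.toSchwartzMap hsm).conductorOp_comp_mul_left ht'
  simp only [HasCompactSupport.toSchwartzMap_toFun] at h1 h2
  change conductorOp (fun u => inversionOp φ (t * u)) 1 = conductorOp (inversionOp φ) t at h1
  change conductorOp f 1 = conductorOp φ t⁻¹ at h2
  rw [← h1, hscale, conductorOp_const_mul_one, conductorOp_inversionOp_one hfsm hfcs hf0, h2]
end
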